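/- Let T be an NTP₂ theory in which every small set is an extension base for non-forking (i.e. tp(a/A) does not fork over A for every tuple a and every set A). Then forking equals dividing over every small set: for every set A and formula φ(x,a), φ(x,a) forks over A if and only if it divides over A. -/

import Mathlib

open FirstOrder

universe u

namespace ForkingNTP2

variable (L : FirstOrder.Language.{u, u}) (M : Type u) [L.Structure M]

/-- Two tuples have the same (complete) type over the parameter set `A`,
computed in the monster model `M`. -/
def EqTypeOver (A : Set M) {δ : Type*} (a b : δ → M) : Prop :=
  ∀ (γ : Type u) (φ : L.Formula (δ ⊕ γ)) (c : γ → M), Set.range c ⊆ A →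
    (φ.Realize (Sum.elim a c) ↔ φ.Realize (Sum.elim b c))

/-- The family of formulas `φ(x, bs i)`, `i < ω`, is `k`-inconsistent: every
`k`-element subset is inconsistent. -/
def KInconsistent {α β : Type*} (k : ℕ) (φ : L.Formula (α ⊕ β)) (bs : ℕ → β → M) : Prop :=
  ∀ s : Finset ℕ, s.card = k → ¬ ∃ x : α → M, ∀ i ∈ s, φ.Realize (Sum.elim x (bs i))

/-- `φ(x, b)` `k`-divides over `A`. -/
def KDivides {α β : Type*} (A : Set M) (k : ℕ) (φ : L.Formula (α ⊕ β)) (b : β → M) : Prop :=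
  ∃ bs : ℕ → β → M, (∀ i, EqTypeOver L M A (bs i) b) ∧ KInconsistent L M k φ bs

/-- `φ(x, b)` divides over `A`. -/
def Divides {α β : Type*} (A : Set M) (φ : L.Formula (α ⊕ β)) (b : β → M) : Prop :=
  ∃ k, KDivides L M A k φ b

/-- `φ(x, b)` forks over `A`: it implies a finite disjunction of formulas,
each of which divides over `A`. -/
def Forks {α β : Type*} (A : Set M) (φ : L.Formula (α ⊕ β)) (b : β → M) : Prop :=
  ∃ (n : ℕ) (γ : Fin n → Type u) (ψ : ∀ i, L.Formula (α ⊕ γ i)) (c : ∀ i, γ i → M),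
    (∀ i, Divides L M A (ψ i) (c i)) ∧
    ∀ x : α → M, φ.Realize (Sum.elim x b) → ∃ i, (ψ i).Realize (Sum.elim x (c i))

/-- The complete type `tp(a / P)` forks over `A`: some formula with parameters
in `P` satisfied by `a` forks over `A`. -/
def TpForks {α : Type*} (A : Set M) (a : α → M) (P : Set M) : Prop :=
  ∃ (γ : Type u) (φ : L.Formula (α ⊕ γ)) (b : γ → M),
    Set.range b ⊆ P ∧ φ.Realize (Sum.elim a b) ∧ Forks L M A φ b

/-- `φ(x, e)` quasi divides over `A`: finitely many `A`-conjugates of `e` make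
the corresponding instances inconsistent. -/
def QuasiDivides {α ε : Type*} (A : Set M) (φ : L.Formula (α ⊕ ε)) (e : ε → M) : Prop :=
  ∃ (m : ℕ) (es : Fin m → ε → M), (∀ j, EqTypeOver L M A (es j) e) ∧
    ¬ ∃ x : α → M, ∀ j, φ.Realize (Sum.elim x (es j))

/-- `f` is an `A`-indiscernible sequence (of `β`-tuples). -/
def IndiscSeq {β : Type*} (A : Set M) (f : ℕ → β → M) : Prop :=
  ∀ (n : ℕ) (g h : Fin n → ℕ), StrictMono g → StrictMono h →
    EqTypeOver L M A (fun p : Fin n × β => f (g p.1) p.2)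
      (fun p : Fin n × β => f (h p.1) p.2)

/-- The automorphism `σ` fixes the set `A` pointwise. -/
def FixesSet (σ : M ≃[L] M) (A : Set M) : Prop := ∀ a ∈ A, σ a = a

/-- `σ` is a Lascar strong automorphism over `A`: a finite product of
automorphisms, each fixing pointwise some small model containing `A`. -/
def IsLascarStrong (κ : Cardinal.{u}) (A : Set M) (σ : M ≃[L] M) : Prop :=
  ∃ l : List (M ≃[L] M),
    (∀ τ ∈ l, ∃ N : L.ElementarySubstructure M,
      Cardinal.mk (N : Set M) < κ ∧ A ⊆ (N : Set M) ∧ FixesSet L M τ (N : Set M)) ∧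
    σ = l.foldr (fun τ ρ => τ.comp ρ) (Language.Equiv.refl L M)

/-- A complete global type in variables `α`: a complete, finitely satisfiable
(in the monster) collection of formulas `φ(x, b)` with parameters `b` in `M`. -/
structure GType (α : Type u) where
  mem : L.Formula (α ⊕ ℕ) → (ℕ → M) → Prop
  finsat : ∀ l : List (L.Formula (α ⊕ ℕ) × (ℕ → M)),
    (∀ q ∈ l, mem q.1 q.2) → ∃ x : α → M, ∀ q ∈ l, q.1.Realize (Sum.elim x q.2)
  complete : ∀ φ b, mem φ b ∨ mem φ.not b

/-- `c` realizes the restriction `p|C` of the global type `p`. -/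
def GType.RealizesRestr {α : Type u} (p : GType L M α) (C : Set M) (c : α → M) : Prop :=
  ∀ (φ : L.Formula (α ⊕ ℕ)) (b : ℕ → M), p.mem φ b → Set.range b ⊆ C →
    φ.Realize (Sum.elim c b)

/-- The global type `p` extends `tp(a / C)`. -/
def GType.Extends {α : Type u} (p : GType L M α) (a : α → M) (C : Set M) : Prop :=
  ∀ (φ : L.Formula (α ⊕ ℕ)) (b : ℕ → M), Set.range b ⊆ C →
    φ.Realize (Sum.elim a b) → p.mem φ b

/-- The global type `p` is invariant under the automorphism `σ`. -/
def GType.InvUnder {α : Type u} (p : GType L M α) (σ : M ≃[L] M) : Prop :=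
  ∀ φ b, p.mem φ b ↔ p.mem φ (fun i => σ (b i))

/-- The global type `p` is (strongly) Lascar invariant over `A`. -/
def GType.LascarInv {α : Type u} (κ : Cardinal.{u}) (A : Set M) (p : GType L M α) : Prop :=
  ∀ σ : M ≃[L] M, IsLascarStrong L M κ A σ → GType.InvUnder L M p σ

/-- The global type `p` forks over `A`. -/
def GType.ForksOver {α : Type u} (p : GType L M α) (A : Set M) : Prop :=
  ∃ (φ : L.Formula (α ⊕ ℕ)) (b : ℕ → M), p.mem φ b ∧ Forks L M A φ b

/-- `a ⫝ⁱ_A B`: `tp(a / A ∪ B)` has a global extension which is Lascar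
invariant over `A`. -/
def IIndep (κ : Cardinal.{u}) {α : Type u} (A : Set M) (a : α → M) (B : Set M) : Prop :=
  ∃ p : GType L M α, GType.Extends L M p a (A ∪ B) ∧ GType.LascarInv L M κ A p

/-- `a ⫝ⁱˢᵗ_A B`: `tp(a / A ∪ B)` has a global extension `p` which is Lascar
invariant over `A` and such that for every `C ⊇ A` and every `c ⊨ p|C`,
`tp(C / A ∪ c)` does not fork over `A` (strict invariance). -/
def IstIndep (κ : Cardinal.{u}) {α : Type u} (A : Set M) (a : α → M) (B : Set M) : Prop :=
  ∃ p : GType L M α, GType.Extends L M p a (A ∪ B) ∧ GType.LascarInv L M κ A p ∧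
    ∀ C : Set M, A ⊆ C → ∀ c : α → M, GType.RealizesRestr L M p C c →
      ¬ TpForks L M A (fun x : C => (x : M)) (A ∪ Set.range c)

/-- `T` has the tree property of the second kind. -/
def TP2 : Prop :=
  ∃ (n m k : ℕ) (φ : L.Formula ((Fin n : Type) ⊕ (Fin m : Type))) (a : ℕ → ℕ → Fin m → M),
    (∀ j : ℕ, KInconsistent L M k φ (fun i => a i j)) ∧
    ∀ f : ℕ → ℕ, ∃ x : Fin n → M, ∀ j : ℕ, φ.Realize (Sum.elim x (a (f j) j))

/-- `T` is NTP₂. -/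
def NTP2 : Prop := ¬ TP2 L M

/-- `T` is dependent (NIP): no formula has the independence property. -/
def IsNIP : Prop :=
  ¬ ∃ (n m : ℕ) (φ : L.Formula ((Fin n : Type) ⊕ (Fin m : Type)))
      (a : ℕ → Fin n → M) (b : Set ℕ → Fin m → M),
    ∀ (i : ℕ) (u : Set ℕ), φ.Realize (Sum.elim (a i) (b u)) ↔ i ∈ u

/-- Forking equals dividing over `A`. -/
def ForkEqDiv (A : Set M) : Prop :=
  ∀ (α β : Type u) (φ : L.Formula (α ⊕ β)) (b : β → M), Forks L M A φ b → Divides L M A φ b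

/-- `A` is an extension base for non-forking: no type over `A` forks over `A`. -/
def ForkingExtBase (A : Set M) : Prop := ∀ (α : Type u) (a : α → M), ¬ TpForks L M A a A

/-- Non-forking has left extension over `A`. -/
def ForkingLeftExt (A : Set M) : Prop :=
  ∀ (α δ β : Type u) (a : α → M) (bb : β → M) (d : α ⊕ δ → M), d ∘ Sum.inl = a →
    ¬ TpForks L M A a (A ∪ Set.range bb) →
    ∃ d' : α ⊕ δ → M, EqTypeOver L M (A ∪ Set.range a) d' d ∧
      ¬ TpForks L M A d' (A ∪ Set.range bb)

/-- `M` is a monster model (κ-saturated and strongly κ-homogeneous). -/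
structure IsMonster (κ : Cardinal.{u}) : Prop where
  aleph0_lt : Cardinal.aleph0 < κ
  saturated : ∀ (A : Set M), Cardinal.mk A < κ → ∀ (α : Type u), Cardinal.mk α < κ →
    ∀ S : Set (L.Formula (α ⊕ ℕ) × (ℕ → M)),
      (∀ q ∈ S, Set.range q.2 ⊆ A) →
      (∀ l : List (L.Formula (α ⊕ ℕ) × (ℕ → M)), (∀ q ∈ l, q ∈ S) →
        ∃ x : α → M, ∀ q ∈ l, q.1.Realize (Sum.elim x q.2)) →
      ∃ x : α → M, ∀ q ∈ S, q.1.Realize (Sum.elim x q.2)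
  homogeneous : ∀ (A : Set M), Cardinal.mk A < κ → ∀ (α : Type u), Cardinal.mk α < κ →
    ∀ a b : α → M, EqTypeOver L M A a b →
      ∃ σ : M ≃[L] M, FixesSet L M σ A ∧ ∀ i, σ (a i) = b i

/-- An abstract pre-independence relation `R A C B` (read `A ⫝_C B`) satisfying
properties (1)-(7): invariance, monotonicity, base monotonicity, right
extension, transitivity on the left, being stronger than invariance, and
preservation of indiscernibles. -/
structure PreIndep (κ : Cardinal.{u}) (R : Set M → Set M → Set M → Prop) : Prop where
  invariance : ∀ (σ : M ≃[L] M) (A C B : Set M),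
    R A C B → R ((fun x => σ x) '' A) ((fun x => σ x) '' C) ((fun x => σ x) '' B)
  monotone : ∀ A A' C B B' : Set M, A' ⊆ A → B' ⊆ B → R A C B → R A' C B'
  baseMono : ∀ A C B D : Set M, R A C (B ∪ D) → R A (C ∪ B) D
  rightExt : ∀ A C B D : Set M, R A C B → B ⊆ D →
    ∃ σ : M ≃[L] M, FixesSet L M σ (B ∪ C) ∧ R A C ((fun x => σ x) '' D)
  leftTrans : ∀ A₁ A₂ C B : Set M, R A₁ C B → R A₂ (C ∪ A₁) (B ∪ A₁) → R (A₁ ∪ A₂) C B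
  strongerInv : ∀ A C B : Set M, R A C B →
    ∃ p : GType L M A, GType.Extends L M p (fun x : A => (x : M)) (B ∪ C) ∧
      GType.LascarInv L M κ C p
  presIndisc : ∀ (β : Type u) (f : ℕ → β → M) (A C : Set M),
    IndiscSeq L M C f → R A C (⋃ i, Set.range (f i)) → IndiscSeq L M (A ∪ C) f

/-- `R` has left extension over `A`. -/
def LeftExtOver (R : Set M → Set M → Set M → Prop) (A : Set M) : Prop :=
  ∀ B C D : Set M, R B A C → B ⊆ D →
    ∃ σ : M ≃[L] M, FixesSet L M σ (A ∪ B) ∧ R ((fun x => σ x) '' D) A C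

/-- `A` is an extension base for `R`: `a ⫝_A A` for every tuple `a`. -/
def RExtBase (R : Set M → Set M → Set M → Prop) (A : Set M) : Prop :=
  ∀ (α : Type u) (a : α → M), R (Set.range a) A A

/-- `σ` and `a` have the same Lascar strong type over `A`. -/
def EqLstp (κ : Cardinal.{u}) {ε : Type*} (A : Set M) (a b : ε → M) : Prop :=
  ∃ σ : M ≃[L] M, IsLascarStrong L M κ A σ ∧ ∀ i, σ (a i) = b i

/-- `φ(x, e)` quasi Lascar divides over `A`. -/
def QuasiLascarDivides (κ : Cardinal.{u}) {α ε : Type*} (A : Set M)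
    (φ : L.Formula (α ⊕ ε)) (e : ε → M) : Prop :=
  ∃ (m : ℕ) (es : Fin m → ε → M), (∀ j, EqLstp L M κ A e (es j)) ∧
    ¬ ∃ x : α → M, ∀ j, φ.Realize (Sum.elim x (es j))

/-- An alternation chain of length `n` for `φ(x, y)`. -/
def AltChain {α β : Type*} (φ : L.Formula (α ⊕ β)) (n : ℕ) : Prop :=
  ∃ (as : ℕ → α → M) (b : β → M), IndiscSeq L M (∅ : Set M) as ∧
    ∀ i : ℕ, i < n - 1 →
      (φ.Realize (Sum.elim (as i) b) ↔ ¬ φ.Realize (Sum.elim (as (i + 1)) b))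

/-- `k` is the alternation number of `φ`. -/
def AltNumber {α β : Type*} (φ : L.Formula (α ⊕ β)) (k : ℕ) : Prop :=
  AltChain L M φ k ∧ ∀ n : ℕ, AltChain L M φ n → n ≤ k


section framework

/-- A type coded by finite tuples of the structure. -/
class Cd (M X : Type u) where
  I : Type u
  fin : Finite I
  e : X ≃ (I → M)

attribute [instance] Cd.fin

instance Cd.tup {M : Type u} (I : Type u) [h : Finite I] : Cd M (I → M) :=
  ⟨I, h, Equiv.refl _⟩

instance Cd.prod {M X Y : Type u} [Cd M X] [Cd M Y] : Cd M (X × Y) where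
  I := Cd.I M X ⊕ Cd.I M Y
  fin := inferInstance
  e := (Equiv.prodCongr Cd.e Cd.e).trans (Equiv.sumArrowEquivProdArrow _ _ _).symm

instance Cd.pow {M X : Type u} [Cd M X] (k : ℕ) : Cd M (Fin k → X) where
  I := Fin k × Cd.I M X
  fin := inferInstance
  e := (Equiv.piCongrRight (fun _ => (Cd.e : X ≃ (Cd.I M X → M)))).trans (Equiv.curry _ _ _).symm

/-- coordinate maps -/
def CM (M : Type u) {X Y : Type u} [Cd M X] [Cd M Y] (f : X → Y) : Prop :=
  ∃ g : Cd.I M Y → Cd.I M X, ∀ x i, (Cd.e (f x) : Cd.I M Y → M) i = Cd.e x (g i)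

/-- definable predicates -/
def DP (A : Set M) {X : Type u} [Cd M X] (P : X → Prop) : Prop :=
  A.Definable L {v : Cd.I M X → M | P (Cd.e.symm v)}

variable {L M}
variable {X Y Z : Type u} [Cd M X] [Cd M Y] [Cd M Z] {A : Set M}

theorem cm_id : CM M (fun x : X => x) := ⟨id, fun _ _ => rfl⟩

theorem cm_comp {f : Y → Z} {g : X → Y} (hf : CM M f) (hg : CM M g) :
    CM M (fun x => f (g x)) := by
  obtain ⟨a, ha⟩ := hf
  obtain ⟨b, hb⟩ := hg
  exact ⟨b ∘ a, fun x i => by rw [ha, hb]; rfl⟩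

theorem cm_fst' : CM M (Prod.fst : X × Y → X) := ⟨Sum.inl, fun _ _ => rfl⟩
theorem cm_snd' : CM M (Prod.snd : X × Y → Y) := ⟨Sum.inr, fun _ _ => rfl⟩
theorem cm_fst {f : Z → X × Y} (h : CM M f) : CM M (fun z => (f z).1) := cm_comp cm_fst' h
theorem cm_snd {f : Z → X × Y} (h : CM M f) : CM M (fun z => (f z).2) := cm_comp cm_snd' h

theorem cm_pair {f : Z → X} {g : Z → Y} (hf : CM M f) (hg : CM M g) :
    CM M (fun z => (f z, g z)) := by
  obtain ⟨a, ha⟩ := hf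
  obtain ⟨b, hb⟩ := hg
  refine ⟨Sum.elim a b, fun x i => ?_⟩
  rcases i with i | i
  · exact ha x i
  · exact hb x i

theorem cm_app {k : ℕ} {f : Z → Fin k → X} (h : CM M f) (i : Fin k) :
    CM M (fun z => f z i) := by
  obtain ⟨a, ha⟩ := h
  exact ⟨fun j => a (i, j), fun x j => ha x (i, j)⟩

theorem cm_pi {k : ℕ} {f : Z → Fin k → X} (h : ∀ i, CM M (fun z => f z i)) :
    CM M (fun z => f z) := by
  choose a ha using h
  exact ⟨fun j => a j.1 j.2, fun x j => ha j.1 x j.2⟩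

theorem cm_cons {k : ℕ} {f : Z → X} {g : Z → Fin k → X} (hf : CM M f) (hg : CM M g) :
    CM M (fun z => (Fin.cons (f z) (g z) : Fin (k+1) → X)) := by
  refine cm_pi (fun i => ?_)
  refine Fin.cases ?_ (fun i => ?_) i
  · simpa using hf
  · simpa using cm_app hg i

theorem dp_congr {P Q : X → Prop} (h : DP L M A P) (hPQ : ∀ x, P x ↔ Q x) : DP L M A Q := by
  have : P = Q := funext fun x => propext (hPQ x)
  exact this ▸ h

theorem dp_not {P : X → Prop} (h : DP L M A P) : DP L M A (fun x => ¬ P x) :=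
  Set.Definable.compl h

theorem dp_and {P Q : X → Prop} (h : DP L M A P) (h' : DP L M A Q) :
    DP L M A (fun x => P x ∧ Q x) := Set.Definable.inter h h'

theorem dp_or {P Q : X → Prop} (h : DP L M A P) (h' : DP L M A Q) :
    DP L M A (fun x => P x ∨ Q x) := Set.Definable.union h h'

theorem dp_imp {P Q : X → Prop} (h : DP L M A P) (h' : DP L M A Q) :
    DP L M A (fun x => P x → Q x) :=
  dp_congr (dp_or (dp_not h) h') (fun x => by tauto)

theorem dp_const (p : Prop) : DP L M A (fun _ : X => p) := by
  by_cases hp : p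
  · refine dp_congr (P := fun _ => True) Set.definable_univ (fun x => by simp [hp])
  · refine dp_congr (P := fun _ => False) Set.definable_empty (fun x => by simp [hp])

theorem dp_fall {ι : Type*} [Finite ι] {P : ι → X → Prop} (h : ∀ i, DP L M A (P i)) :
    DP L M A (fun x => ∀ i, P i x) := by
  have := Set.definable_iInter_of_finite h
  unfold DP
  convert this using 1
  ext v
  simp

theorem dp_fex {ι : Type*} [Finite ι] {P : ι → X → Prop} (h : ∀ i, DP L M A (P i)) :
    DP L M A (fun x => ∃ i, P i x) := by
  have := Set.definable_iUnion_of_finite h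
  unfold DP
  convert this using 1
  ext v
  simp

theorem dp_comp {P : Y → Prop} {f : X → Y} (h : DP L M A P) (hf : CM M f) :
    DP L M A (fun x => P (f x)) := by
  obtain ⟨g, hg⟩ := hf
  have := Set.Definable.preimage_comp g h
  unfold DP
  convert this using 1
  ext v
  show P _ ↔ P _
  have : f (Cd.e.symm v) = Cd.e.symm (v ∘ g) := by
    rw [Equiv.eq_symm_apply]
    ext i
    rw [hg]
    simp
  rw [this]

/-- definable relations -/
def DR (L : FirstOrder.Language.{u, u}) (M : Type u) [L.Structure M] (A : Set M) {X Y : Type u}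
    [Cd M X] [Cd M Y] (R : X → Y → Prop) : Prop :=
  DP L M A (fun p : X × Y => R p.1 p.2)

theorem dp_rel {R : X → Y → Prop} {f : Z → X} {g : Z → Y} (h : DR L M A R) (hf : CM M f)
    (hg : CM M g) : DP L M A (fun z => R (f z) (g z)) :=
  dp_comp (P := fun p : X × Y => R p.1 p.2) h (cm_pair hf hg)

theorem dp_ex {R : X → Y → Prop} (h : DP L M A (fun p : X × Y => R p.1 p.2)) :
    DP L M A (fun x => ∃ y, R x y) := by
  have := Set.Definable.exists_of_finite h
  unfold DP
  convert this using 1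
  ext v
  show (∃ y, R _ y) ↔ (∃ u, R _ _)
  constructor
  · rintro ⟨y, hy⟩
    refine ⟨(Cd.e : Y ≃ (Cd.I M Y → M)) y, ?_⟩
    have h2 := (Cd.e : Y ≃ (Cd.I M Y → M)).symm_apply_apply y
    have : R ((Cd.e : X ≃ (Cd.I M X → M)).symm v)
        ((Cd.e : Y ≃ (Cd.I M Y → M)).symm ((Cd.e : Y ≃ (Cd.I M Y → M)) y)) := by
      rw [h2]; exact hy
    exact this
  · rintro ⟨u, hu⟩
    exact ⟨_, hu⟩

theorem dp_all {R : X → Y → Prop} (h : DP L M A (fun p : X × Y => R p.1 p.2)) :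
    DP L M A (fun x => ∀ y, R x y) :=
  dp_congr (dp_not (dp_ex (R := fun x y => ¬ R x y) (dp_not h))) (fun x => by simp)

theorem dp_mono {P : X → Prop} {B : Set M} (h : DP L M A P) (hAB : A ⊆ B) : DP L M B P :=
  Set.Definable.mono h hAB

theorem dp_univ {P : X → Prop} (h : DP L M A P) : DP L M Set.univ P :=
  dp_mono h (Set.subset_univ _)

/-- Parameter extraction. -/
theorem dp_params {P : X → Prop} (h : DP L M Set.univ P) :
    ∃ (F : Type u) (_ : Finite F) (m : F → M) (E : (F → M) → X → Prop),
      DR L M ∅ E ∧ ∀ x, P x ↔ E m x := by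
  obtain ⟨A0, -, hA0⟩ := Set.definable_iff_finitely_definable.1 h
  obtain ⟨φ, hφ⟩ := Set.definable_iff_exists_formula_sum.1 hA0
  refine ⟨(A0 : Set M), inferInstance, Subtype.val, fun v x => φ.Realize (Sum.elim v (Cd.e x)), ?_, ?_⟩
  · refine Set.empty_definable_iff.2 ⟨φ, ?_⟩
    ext v
    show φ.Realize _ ↔ φ.Realize _
    apply iff_of_eq
    congr 1
    ext i
    rcases i with i | i
    · rfl
    · show Cd.e (Cd.e.symm (v ∘ Sum.inr)) i = _
      simp
  · intro x
    have := congrArg (fun s => Cd.e x ∈ s) hφ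
    simpa using this

/-- fixing a parameter -/
theorem dp_fix' {R : X → Y → Prop} (h : DR L M A R) (x : X)
    (hx : ∀ i : Cd.I M X, (Cd.e x : Cd.I M X → M) i ∈ A) : DP L M A (R x) := by
  obtain ⟨φ, hφ⟩ := Set.definable_iff_exists_formula_sum.1 h
  refine Set.definable_iff_exists_formula_sum.2
    ⟨φ.relabel (Sum.elim Sum.inl (Sum.elim (fun i => Sum.inl ⟨Cd.e x i, hx i⟩) Sum.inr)), ?_⟩
  ext v
  have := congrArg (fun s => Cd.e ((x, Cd.e.symm v) : X × Y) ∈ s) hφ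
  simp only [Set.mem_ofPred_eq, Equiv.symm_apply_apply, eq_iff_iff] at this
  rw [Set.mem_ofPred_eq, this, Set.mem_ofPred_eq, Language.Formula.realize_relabel]
  apply iff_of_eq
  congr 1
  ext i
  rcases i with i | i | i
  · rfl
  · rfl
  · show Cd.e (Cd.e.symm v) i = _
    simp

theorem dp_fix {R : X → Y → Prop} (h : DR L M Set.univ R) (x : X) : DP L M Set.univ (R x) :=
  dp_fix' h x (fun _ => trivial)

/-- over A, formula form -/
theorem dp_formula {P : X → Prop} (h : DP L M A P) :
    ∃ φ : L.Formula (Cd.I M X ⊕ A), ∀ x : X, P x ↔ φ.Realize (Sum.elim (Cd.e x) (fun a : A => (a : M))) := by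
  obtain ⟨φ, hφ⟩ := Set.definable_iff_exists_formula_sum.1 h
  refine ⟨φ.relabel Sum.swap, fun x => ?_⟩
  have := congrArg (fun s => Cd.e x ∈ s) hφ
  simp only [Set.mem_ofPred_eq, Equiv.symm_apply_apply, eq_iff_iff] at this
  rw [this, Language.Formula.realize_relabel]
  apply iff_of_eq
  congr 1
  funext i
  rcases i with i | i <;> rfl

theorem dp_of_formula {γ : Type u} (φ : L.Formula (Cd.I M X ⊕ γ)) (c : γ → M)
    (hc : ∀ i, c i ∈ A) : DP L M A (fun x : X => φ.Realize (Sum.elim (Cd.e x) c)) := by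
  refine Set.definable_iff_exists_formula_sum.2
    ⟨φ.relabel (Sum.elim Sum.inr (fun i => Sum.inl ⟨c i, hc i⟩)), ?_⟩
  ext v
  rw [Set.mem_ofPred_eq, Set.mem_ofPred_eq, Language.Formula.realize_relabel]
  beta_reduce
  apply iff_of_eq
  congr 1
  funext i
  rcases i with i | i
  · show Cd.e (Cd.e.symm v) i = _
    simp
  · rfl

end framework
section saturation

variable {L M}

theorem sat {κ : Cardinal.{u}} (hM : IsMonster L M κ) (C : Set M) (hC : Cardinal.mk C < κ)
    (ι : Type u) (hι : Cardinal.mk ι < κ) {J : Type*} (S : J → Set (ι → M))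
    (hS : ∀ j, C.Definable L (S j)) (hfip : ∀ t : Finset J, ∃ x, ∀ j ∈ t, x ∈ S j) :
    ∃ x, ∀ j, x ∈ S j := by
  classical
  rcases isEmpty_or_nonempty M with hE | ⟨⟨m0⟩⟩
  · obtain ⟨x, hx⟩ := hfip ∅
    refine ⟨x, fun j => ?_⟩
    obtain ⟨y, hy⟩ := hfip {j}
    have : x = y := funext fun i => (hE.false (x i)).elim
    rw [this]
    exact hy j (by simp)
  have key : ∀ j, ∃ q : L.Formula (ι ⊕ ℕ) × (ℕ → M), Set.range q.2 ⊆ insert m0 C ∧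
      ∀ x, x ∈ S j ↔ q.1.Realize (Sum.elim x q.2) := by
    intro j
    obtain ⟨A0, hA0, hd⟩ := Set.definable_iff_finitely_definable.1 (hS j)
    obtain ⟨φ, hφ⟩ := Set.definable_iff_exists_formula_sum.1 hd
    let b : ℕ → M := fun n => if h : n < A0.card then (A0.equivFin.symm ⟨n, h⟩ : M) else m0
    refine ⟨(φ.relabel (Sum.elim (fun a : A0 => Sum.inr (A0.equivFin a : ℕ)) Sum.inl), b), ?_, ?_⟩
    · rintro _ ⟨n, rfl⟩
      by_cases h : n < A0.card
      · simp only [b, h, dif_pos]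
        exact Or.inr (hA0 (A0.equivFin.symm ⟨n, h⟩).2)
      · simp only [b, h, dif_neg, not_false_eq_true]
        exact Or.inl rfl
    · intro x
      rw [hφ, Set.mem_ofPred_eq, Language.Formula.realize_relabel]
      apply iff_of_eq
      congr 1
      funext i
      rcases i with i | i
      · simp [b]
      · rfl
  choose q hq1 hq2 using key
  have hκ : Cardinal.aleph0 ≤ κ := hM.aleph0_lt.le
  have := hM.saturated (insert m0 C)
    (lt_of_le_of_lt (Cardinal.mk_insert_le) (Cardinal.add_lt_of_lt hκ hC
      (lt_of_lt_of_le Cardinal.one_lt_aleph0 hκ))) ι hι (Set.range q) ?_ ?_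
  · obtain ⟨x, hx⟩ := this
    exact ⟨x, fun j => (hq2 j x).2 (hx _ ⟨j, rfl⟩)⟩
  · rintro _ ⟨j, rfl⟩
    exact hq1 j
  · intro l hl
    have : ∃ t : Finset J, ∀ p ∈ l, ∃ j ∈ t, p = q j := by
      induction l with
      | nil => exact ⟨∅, by simp⟩
      | cons p l ih =>
        obtain ⟨t, ht⟩ := ih (fun q hq => hl q (by simp [hq]))
        obtain ⟨j, hj⟩ := hl p (by simp)
        refine ⟨insert j t, ?_⟩
        intro p' hp'
        rcases List.mem_cons.1 hp' with rfl | h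
        · exact ⟨j, by simp, hj.symm⟩
        · obtain ⟨j', h1, h2⟩ := ht p' h
          exact ⟨j', by simp [h1], h2⟩
    obtain ⟨t, ht⟩ := this
    obtain ⟨x, hx⟩ := hfip t
    refine ⟨x, fun p hp => ?_⟩
    obtain ⟨j, hj, rfl⟩ := ht p hp
    exact (hq2 j x).1 (hx j hj)

/-- saturation for sequences -/
theorem sat_seq {κ : Cardinal.{u}} (hM : IsMonster L M κ) (A : Set M) (hA : Cardinal.mk A < κ)
    {D : Type u} [Cd M D] {J : Type*} (n : J → ℕ) (g : ∀ j, Fin (n j) → ℕ)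
    (P : ∀ j, (Fin (n j) → D) → Prop) (hP : ∀ j, DP L M A (P j))
    (hfip : ∀ t : Finset J, ∃ s : ℕ → D, ∀ j ∈ t, P j (fun i => s (g j i))) :
    ∃ s : ℕ → D, ∀ j, P j (fun i => s (g j i)) := by
  let ι := ULift.{u} ℕ × Cd.I M D
  let dec : (ι → M) → ℕ → D := fun v i => Cd.e.symm (fun k => v (⟨i⟩, k))
  have hι : Cardinal.mk ι < κ := lt_of_le_of_lt Cardinal.mk_le_aleph0 hM.aleph0_lt
  have hh := sat hM A hA ι hι (fun j => {v | P j (fun i => dec v (g j i))}) ?_ ?_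
  · obtain ⟨x, hx⟩ := hh
    exact ⟨dec x, hx⟩
  · intro j
    exact Set.Definable.preimage_comp (fun p : Cd.I M (Fin (n j) → D) =>
      ((⟨g j p.1⟩, p.2) : ι)) (hP j)
  · intro t
    obtain ⟨s, hs⟩ := hfip t
    refine ⟨fun p => Cd.e (s p.1.down) p.2, fun j hj => ?_⟩
    have : dec (fun p => Cd.e (s p.1.down) p.2) = s := by
      funext i
      simp [dec]
    show P j _
    rw [this]
    exact hs j hj

/-- k-inconsistency -/
def KInc {C D J : Type*} (k : ℕ) (η : C → D → Prop) (s : J → D) : Prop :=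
  ∀ t : Finset J, t.card = k → ¬ ∃ c, ∀ j ∈ t, η c (s j)

theorem KInc.comp {C D J J' : Type*} {k : ℕ} {η : C → D → Prop} {s : J → D} (h : KInc k η s)
    (g : J' → J) (hg : Function.Injective g) : KInc k η (fun j => s (g j)) := by
  classical
  rintro t ht ⟨c, hc⟩
  refine h (t.image g) (by rw [Finset.card_image_of_injective _ hg, ht]) ⟨c, ?_⟩
  intro j hj
  obtain ⟨i, hi, rfl⟩ := Finset.mem_image.1 hj
  exact hc i hi

theorem dp_kinc {A : Set M} {C D Z : Type u} [Cd M C] [Cd M D] [Cd M Z] {J : Type*} [Finite J]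
    {η : C → D → Prop}
    (h : DR L M A η) (k : ℕ) (f : Z → J → D) (hf : ∀ j, CM M (fun z => f z j)) :
    DP L M A (fun z => KInc k η (f z)) := by
  unfold KInc
  refine dp_fall (fun t => dp_imp (dp_const _) (dp_not (dp_ex (dp_fall fun j => dp_imp (dp_const _) ?_))))
  exact dp_rel h cm_snd' (cm_comp (hf j) cm_fst')

theorem noArr {κ : Cardinal.{u}} (hM : IsMonster L M κ) (hT : NTP2 L M)
    {C D : Type u} [Cd M C] [Cd M D] {η : C → D → Prop} (hη : DR L M Set.univ η) (k : ℕ) :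
    ¬ ∀ p : ℕ, ∃ u : Fin p → Fin p → D, (∀ j, KInc k η (u j)) ∧
      ∀ f : Fin p → Fin p, ∃ c, ∀ j, η c (u j (f j)) := by
  classical
  intro H
  obtain ⟨A0, -, hA0⟩ := Set.definable_iff_finitely_definable.1 hη
  have hA0 : DR L M (A0 : Set M) η := hA0
  have hsm : Cardinal.mk (A0 : Set M) < κ :=
    lt_of_le_of_lt Cardinal.mk_le_aleph0 hM.aleph0_lt
  have hDne : Nonempty D := by
    obtain ⟨u, -⟩ := H 1
    exact ⟨u 0 0⟩
  obtain ⟨d0⟩ := hDne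
  -- infinite array
  have step1 : ∃ s : ℕ → D, (∀ j, KInc k η (fun i => s (Nat.pair j i))) ∧
      ∀ (n : ℕ) (f : Fin n → ℕ), ∃ c, ∀ j : Fin n, η c (s (Nat.pair j (f j))) := by
    have hh := sat_seq (J := (ℕ × ℕ) ⊕ (Σ n : ℕ, Fin n → ℕ)) hM (A0 : Set M) hsm (D := D)
      (fun q => match q with
        | .inl q => q.2
        | .inr q => q.1)
      (fun q => match q with
        | .inl q => fun i => Nat.pair q.1 i
        | .inr q => fun j => Nat.pair j (q.2 j))
      (fun q => match q with
        | .inl q => fun s => KInc k η s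
        | .inr q => fun s => ∃ c, ∀ j, η c (s j)) ?_ ?_
    · obtain ⟨s, hs⟩ := hh
      refine ⟨s, fun j t ht => ?_, fun n f => hs (.inr ⟨n, f⟩)⟩
      rintro ⟨c, hc⟩
      have h1 : KInc k η (fun i : Fin (t.sup id + 1) => s (Nat.pair j i)) :=
        hs (.inl (j, t.sup id + 1))
      have hlt : ∀ m ∈ t, m < t.sup id + 1 := fun m hm =>
        Nat.lt_succ_of_le (Finset.le_sup (f := id) hm)
      refine h1 (t.attachFin hlt) (by simpa using ht) ⟨c, fun i hi => hc i (by simpa using hi)⟩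
    · rintro (q | q)
      · exact dp_kinc hA0 k _ (fun j => cm_app cm_id j)
      · exact dp_ex (dp_fall (fun j => dp_rel hA0 cm_snd' (cm_app cm_fst' j)))
    · intro t
      -- bound
      have : ∃ p : ℕ, ∀ q ∈ t, match q with
        | .inl q => q.1 < p ∧ q.2 ≤ p
        | .inr q => q.1 ≤ p ∧ ∀ j, q.2 j < p := by
        induction t using Finset.induction with
        | empty => exact ⟨0, by simp⟩
        | insert q t hq ih =>
          obtain ⟨p, hp⟩ := ih
          have : ∃ p' : ℕ, match q with
            | .inl q => q.1 < p' ∧ q.2 ≤ p'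
            | .inr q => q.1 ≤ p' ∧ ∀ j, q.2 j < p' := by
            rcases q with q | q
            · exact ⟨q.1 + q.2 + 1, by simp only; omega⟩
            · refine ⟨q.1 + Finset.univ.sup q.2 + 1, ?_, fun j => ?_⟩
              · omega
              · have := Finset.le_sup (f := q.2) (Finset.mem_univ j)
                omega
          obtain ⟨p', hp'⟩ := this
          refine ⟨max p p', fun r hr => ?_⟩
          rcases Finset.mem_insert.1 hr with rfl | hr
          · rcases r with r | r
            · simp only at hp' ⊢; omega
            · exact ⟨hp'.1.trans (le_max_right _ _), fun j => lt_of_lt_of_le (hp'.2 j) (le_max_right _ _)⟩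
          · have := hp r hr
            rcases r with r | r
            · simp only at this ⊢; omega
            · exact ⟨this.1.trans (le_max_left _ _), fun j => lt_of_lt_of_le (this.2 j) (le_max_left _ _)⟩
      obtain ⟨p, hp⟩ := this
      obtain ⟨u, hu1, hu2⟩ := H p
      let s : ℕ → D := fun n => if h : (Nat.unpair n).1 < p ∧ (Nat.unpair n).2 < p then
        u ⟨_, h.1⟩ ⟨_, h.2⟩ else d0
      have hs : ∀ (j i : Fin p), s (Nat.pair j i) = u j i := by
        intro j i
        simp [s]
      refine ⟨s, ?_⟩
      rintro (q | q) hq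
      · obtain ⟨h1, h2⟩ := hp _ hq
        have := (hu1 ⟨q.1, h1⟩).comp (Fin.castLE h2) (Fin.castLE_injective h2)
        show KInc k η _
        convert this using 2 with i
        exact hs ⟨q.1, h1⟩ (Fin.castLE h2 i)
      · obtain ⟨h1, h2⟩ := hp _ hq
        obtain ⟨c, hc⟩ := hu2 (fun j => if h : (j : ℕ) < q.1 then ⟨q.2 ⟨j, h⟩, h2 _⟩ else j)
        refine ⟨c, fun j => ?_⟩
        have := hc (Fin.castLE h1 j)
        rw [← hs] at this
        simpa using this
  obtain ⟨s, hs1, hs2⟩ := step1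
  -- infinite paths
  have step2 : ∀ f : ℕ → ℕ, ∃ c, ∀ j, η c (s (Nat.pair j (f j))) := by
    intro f
    let B : Set M := A0 ∪ ⋃ n, Set.range (Cd.e (s n) : Cd.I M D → M)
    have hB : Cardinal.mk B < κ := by
      refine lt_of_le_of_lt ?_ hM.aleph0_lt
      refine Set.Countable.le_aleph0 (Set.Countable.union A0.countable_toSet ?_)
      exact Set.countable_iUnion (fun n => Set.countable_range _)
    have hh := sat hM B hB (Cd.I M C)
      (lt_of_le_of_lt Cardinal.mk_le_aleph0 hM.aleph0_lt)
      (fun j : ℕ => {v | η (Cd.e.symm v) (s (Nat.pair j (f j)))}) ?_ ?_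
    · obtain ⟨x, hx⟩ := hh
      exact ⟨Cd.e.symm x, hx⟩
    · intro j
      have h1 : DR L M B (fun d c => η c d) := dp_rel (dp_mono hA0 Set.subset_union_left : DR L M B η) cm_snd' cm_fst'
      refine dp_fix' h1 (s (Nat.pair j (f j))) (fun i => Or.inr ?_)
      exact Set.mem_iUnion.2 ⟨_, ⟨i, rfl⟩⟩
    · intro t
      obtain ⟨c, hc⟩ := hs2 (t.sup id + 1) (fun j => f j)
      refine ⟨Cd.e c, fun j hj => ?_⟩
      have := hc ⟨j, Nat.lt_succ_of_le (Finset.le_sup (f := id) hj)⟩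
      simpa using this
  -- conclude
  obtain ⟨φ, hφ⟩ := dp_formula hA0
  obtain ⟨n, ⟨e1⟩⟩ := Finite.exists_equiv_fin (Cd.I M C)
  obtain ⟨m, ⟨e2⟩⟩ := Finite.exists_equiv_fin (Cd.I M D ⊕ A0)
  let φ' : L.Formula (Fin n ⊕ Fin m) := φ.relabel
    (Sum.elim (Sum.elim (fun i => Sum.inl (e1 i)) (fun i => Sum.inr (e2 (Sum.inl i))))
      (fun a => Sum.inr (e2 (Sum.inr a))))
  let a : ℕ → ℕ → Fin m → M := fun i j x =>
    Sum.elim (Cd.e (s (Nat.pair j i))) (fun a : A0 => (a : M)) (e2.symm x)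
  have hφ' : ∀ (x : Fin n → M) i j, φ'.Realize (Sum.elim x (a i j)) ↔
      η (Cd.e.symm (fun i => x (e1 i))) (s (Nat.pair j i)) := by
    intro x i j
    have := hφ (Cd.e.symm (fun i => x (e1 i)), s (Nat.pair j i))
    simp only at this
    rw [this, Language.Formula.realize_relabel]
    apply iff_of_eq
    congr 1
    funext i
    rcases i with (i | i) | i
    · show x (e1 i) = (Cd.e (Cd.e.symm (fun i => x (e1 i))) : Cd.I M C → M) i
      simp
    · show Sum.elim _ _ (e2.symm (e2 _)) = _
      simp
      rfl
    · show Sum.elim _ _ (e2.symm (e2 _)) = _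
      simp
  refine hT ⟨n, m, k, φ', a, ?_, ?_⟩
  · rintro j t ht ⟨x, hx⟩
    exact hs1 j t ht ⟨_, fun i hi => (hφ' x i j).1 (hx i hi)⟩
  · intro f
    obtain ⟨c, hc⟩ := step2 f
    refine ⟨fun i => Cd.e c (e1.symm i), fun j => (hφ' _ _ _).2 ?_⟩
    simpa using hc j

end saturation
section ultra

variable {L M}

theorem dirUlt {X : Type*} {J : Type*} [Nonempty J] (S : J → Set X)
    (hdir : ∀ i j, ∃ k, S k ⊆ S i ∧ S k ⊆ S j) (hne : ∀ j, (S j).Nonempty) :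
    ∃ r : Ultrafilter X, ∀ j, S j ∈ r := by
  have : Filter.NeBot (⨅ j, Filter.principal (S j)) := by
    obtain ⟨j0⟩ := ‹Nonempty J›
    have : Nonempty X := ⟨(hne j0).some⟩
    refine Filter.iInf_neBot_of_directed ?_ (fun j => Filter.principal_neBot_iff.2 (hne j))
    intro i j
    obtain ⟨k, h1, h2⟩ := hdir i j
    exact ⟨k, Filter.principal_mono.2 h1, Filter.principal_mono.2 h2⟩
  refine ⟨Ultrafilter.of (⨅ j, Filter.principal (S j)), fun j => ?_⟩
  have h1 : S j ∈ (⨅ j, Filter.principal (S j)) :=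
    Filter.mem_iInf_of_mem j (Filter.mem_principal_self _)
  exact Ultrafilter.of_le _ h1

/-- product of ultrafilters -/
def UP {X Y : Type*} (V : Ultrafilter X) (q : Ultrafilter Y) : Ultrafilter (X × Y) :=
  V.bind (fun x => q.map (Prod.mk x))

theorem ev_UP {X Y : Type*} {V : Ultrafilter X} {q : Ultrafilter Y} {P : X × Y → Prop} :
    (∀ᶠ z in UP V q, P z) ↔ ∀ᶠ x in V, ∀ᶠ y in q, P (x, y) := Iff.rfl

/-- iterated product of ultrafilters -/
def PQ {X : Type*} : (m : ℕ) → (Fin m → Ultrafilter X) → Ultrafilter (Fin m → X)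
  | 0, _ => pure Fin.elim0
  | m + 1, qs => (qs 0).bind (fun s => (PQ m (fun i => qs i.succ)).map (Fin.cons s))

theorem ev_PQ_zero {X : Type*} {qs : Fin 0 → Ultrafilter X} {P : (Fin 0 → X) → Prop} :
    (∀ᶠ s in PQ 0 qs, P s) ↔ P Fin.elim0 := Iff.rfl

theorem ev_PQ_succ {X : Type*} {m : ℕ} {qs : Fin (m + 1) → Ultrafilter X}
    {P : (Fin (m + 1) → X) → Prop} :
    (∀ᶠ s in PQ (m + 1) qs, P s) ↔
      ∀ᶠ x in qs 0, ∀ᶠ s in PQ m (fun i => qs i.succ), P (Fin.cons x s) := Iff.rfl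

theorem ev_PQ_map {X Y : Type*} {m : ℕ} {qs : Fin m → Ultrafilter X} {g : Fin m → X → Y}
    {P : (Fin m → Y) → Prop} :
    (∀ᶠ s in PQ m (fun i => (qs i).map (g i)), P s) ↔
      ∀ᶠ s : Fin m → X in PQ m qs, P (fun i => g i (s i)) := by
  induction m with
  | zero =>
    rw [ev_PQ_zero, ev_PQ_zero]
    apply iff_of_eq
    congr 1
    funext i
    exact i.elim0
  | succ m ih =>
    rw [ev_PQ_succ, ev_PQ_succ]
    show (∀ᶠ x : X in qs 0, _) ↔ _
    refine Filter.eventually_congr (Filter.Eventually.of_forall fun x => ?_)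
    refine (ih (qs := fun i => qs i.succ) (g := fun i => g i.succ)
      (P := fun s => P (Fin.cons (g 0 x) s))).trans ?_
    apply iff_of_eq
    congr 1
    funext s
    congr 1
    funext i
    refine Fin.cases ?_ (fun i => ?_) i <;> simp

theorem ev_PQ_all {X : Type*} {m : ℕ} {qs : Fin m → Ultrafilter X} {P : Fin m → X → Prop}
    (h : ∀ l, ∀ᶠ x in qs l, P l x) : ∀ᶠ s : Fin m → X in PQ m qs, ∀ l, P l (s l) := by
  induction m with
  | zero => exact fun l => l.elim0
  | succ m ih =>
    rw [ev_PQ_succ]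
    filter_upwards [h 0] with x hx
    filter_upwards [ih (qs := fun i => qs i.succ) (P := fun i => P i.succ) (fun l => h l.succ)] with s hs
    intro l
    refine Fin.cases ?_ (fun i => ?_) l
    · simpa using hx
    · simpa using hs i

variable (L M) in
/-- dividing over A, semantic version -/
def DivA (A : Set M) {C D : Type u} [Cd M D] (η : C → D → Prop) (d : D) (k : ℕ) : Prop :=
  ∃ ds : ℕ → D, (∀ i, ∀ P : D → Prop, DP L M A P → (P (ds i) ↔ P d)) ∧ KInc k η ds

theorem exists_p0 {A : Set M} (hA : ForkingExtBase L M A) {D : Type u} [Cd M D] (d : D) :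
    ∃ p0 : Ultrafilter D, ∀ (C : Type u) (_ : Cd M C) (η : C → D → Prop), DR L M A η →
      ∀ k, DivA L M A η d k → ∀ c, ∀ᶠ s in p0, ¬ η c s := by
  classical
  have := Ultrafilter.exists_ultrafilter_of_finite_inter_nonempty
    {G : Set D | ∃ (C : Type u) (_ : Cd M C) (η : C → D → Prop), DR L M A η ∧
      ∃ k, DivA L M A η d k ∧ ∃ c, G = {s | ¬ η c s}} ?_
  · obtain ⟨p0, hp0⟩ := this
    exact ⟨p0, fun C hC η hη k hk c => hp0 ⟨C, hC, η, hη, k, hk, c, rfl⟩⟩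
  intro T hT
  by_contra hne
  rw [Set.not_nonempty_iff_eq_empty] at hne
  let n := T.card
  have hT' : ∀ i : Fin n, _ := fun i => hT (T.equivFin.symm i).2
  choose C hC η hη k hk c hc using hT'
  have hcov : ∀ s, ∃ i, η i (c i) s := by
    intro s
    by_contra hcon
    push Not at hcon
    have : s ∈ ⋂₀ (↑T : Set (Set D)) := by
      intro G hG
      have h1 := hc (T.equivFin ⟨G, hG⟩)
      simp only [Equiv.symm_apply_apply] at h1
      rw [h1]
      exact hcon _
    rw [hne] at this
    exact this
  let α : Type u := Σ i : Fin n, Cd.I M (C i)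
  let pr : ∀ i, (α → M) → C i := fun i x => Cd.e.symm (fun j => x ⟨i, j⟩)
  have hpr : ∀ i, CM M (pr i) := fun i => ⟨fun j => ⟨i, j⟩, fun x j => by
    simp only [pr, Equiv.apply_symm_apply]; rfl⟩
  have hE : DP L M A (fun x : α → M => ∀ s : D, ∃ i, η i (pr i x) s) := by
    refine dp_all (dp_fex (fun i => ?_))
    exact dp_rel (hη i) (cm_comp (hpr i) cm_fst') cm_snd'
  obtain ⟨φ, hφ⟩ := dp_formula hE
  have hψ : ∀ i, ∃ ψ : L.Formula (α ⊕ (Cd.I M D ⊕ A)), ∀ (x : α → M) (s : D),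
      ψ.Realize (Sum.elim x (Sum.elim (Cd.e s) (fun a : A => (a : M)))) ↔ η i (pr i x) s := by
    intro i
    have h1 : DP L M A (fun p : (α → M) × D => η i (pr i p.1) p.2) :=
      dp_rel (hη i) (cm_comp (hpr i) cm_fst') cm_snd'
    obtain ⟨ψ, hψ⟩ := dp_formula h1
    refine ⟨ψ.relabel (Equiv.sumAssoc _ _ _), fun x s => ?_⟩
    rw [hψ (x, s), Language.Formula.realize_relabel]
    apply iff_of_eq
    congr 1
    funext i
    rcases i with (i | i) | i <;> rfl
  choose ψ hψ using hψ
  refine hA α (fun p => Cd.e (c p.1) p.2) ⟨A, φ, fun a => a, ?_, ?_, n, fun _ => Cd.I M D ⊕ A, ψ,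
    fun _ => Sum.elim (Cd.e d) (fun a : A => (a : M)), ?_, ?_⟩
  · rintro _ ⟨a, rfl⟩
    exact a.2
  · refine (hφ _).1 (fun s => ?_)
    obtain ⟨i, hi⟩ := hcov s
    refine ⟨i, ?_⟩
    have : pr i (fun p => Cd.e (c p.1) p.2) = c i := Cd.e.symm_apply_apply (c i)
    exact this.symm ▸ hi
  · intro i
    obtain ⟨ds, h1, h2⟩ := hk i
    refine ⟨k i, fun j => Sum.elim (Cd.e (ds j)) (fun a : A => (a : M)), fun j γ χ b hb => ?_, ?_⟩
    · have h3 := h1 j _ (dp_of_formula (A := A) (X := D) (χ.relabel (Equiv.sumAssoc _ _ _))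
        (Sum.elim (fun a : A => (a : M)) b) ?_)
      · rw [Language.Formula.realize_relabel, Language.Formula.realize_relabel] at h3
        convert h3 using 2
        · funext i; rcases i with (i | i) | i <;> rfl
        · funext i; rcases i with (i | i) | i <;> rfl
      · rintro (i | i)
        · exact i.2
        · exact hb ⟨i, rfl⟩
    · rintro t ht ⟨x, hx⟩
      exact h2 t ht ⟨pr i x, fun j hj => (hψ i x _).1 (hx j hj)⟩
  · intro x hx
    obtain ⟨i, hi⟩ := (hφ x).2 hx d
    exact ⟨i, (hψ i x d).2 hi⟩

variable (L M) in
/-- the type of strong dividing relative to an ultrafilter -/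
def DivP {C D : Type u} [Cd M D] (p0 : Ultrafilter D) (η : C → D → Prop) (k : ℕ) : Prop :=
  ∀ P : D → Prop, DP L M Set.univ P → (∀ᶠ s in p0, P s) → ∀ p : ℕ, ∃ s : Fin p → D,
    (∀ j, P (s j)) ∧ KInc k η s

theorem divP_of_divA {A : Set M} {D : Type u} [Cd M D] {d : D} {p0 : Ultrafilter D}
    (hp0 : ∀ (C : Type u) (_ : Cd M C) (η : C → D → Prop), DR L M A η →
      ∀ k, DivA L M A η d k → ∀ c, ∀ᶠ s in p0, ¬ η c s)
    {C : Type u} [Cd M C] {η : C → D → Prop} (hη : DR L M A η) {k : ℕ} (hk : DivA L M A η d k) :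
    DivP L M p0 η k := by
  intro P hP hPl p
  rcases Nat.eq_zero_or_pos p with rfl | hp
  · refine ⟨Fin.elim0, fun j => j.elim0, ?_⟩
    obtain ⟨ds, h1, h2⟩ := hk
    rintro t ht ⟨c, hc⟩
    have : t = ∅ := Finset.eq_empty_of_isEmpty t
    subst this
    refine h2 ∅ ?_ ⟨c, by simp⟩
    simpa using ht
  obtain ⟨F, hF, m, E, hE, hPE⟩ := dp_params hP
  have hE : DR L M A E := dp_mono hE (Set.empty_subset _)
  let Ξ : (F → M) → Prop := fun c => ∃ s : Fin p → D, (∀ j, E c (s j)) ∧ KInc k η s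
  have hΞ : DP L M A Ξ := by
    refine dp_ex (dp_and (dp_fall fun j => dp_rel hE cm_fst' (cm_app cm_snd' j)) ?_)
    exact dp_kinc hη k _ (fun j => cm_app cm_snd' j)
  have hE' : DR L M A (fun c s => E c s ∧ ¬ Ξ c) := dp_and hE (dp_not (dp_comp hΞ cm_fst'))
  have key := hp0 (F → M) inferInstance _ hE' p ?_ m
  · obtain ⟨s, hs1, hs2⟩ := (key.and hPl).exists
    have : Ξ m := by
      by_contra hcon
      exact hs1 ⟨(hPE s).1 hs2, hcon⟩
    obtain ⟨s, h1, h2⟩ := this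
    exact ⟨s, fun j => (hPE _).2 (h1 j), h2⟩
  · obtain ⟨ds, h1, h2⟩ := hk
    refine ⟨ds, h1, ?_⟩
    rintro t ht ⟨c, hc⟩
    have hne : t.Nonempty := Finset.card_pos.1 (ht ▸ hp)
    obtain ⟨i, hi⟩ := hne
    refine (hc i hi).2 ⟨fun j => ds (t.orderEmbOfFin ht j), fun j => (hc _ ?_).1, ?_⟩
    · exact Finset.orderEmbOfFin_mem t ht j
    · exact h2.comp _ (t.orderEmbOfFin ht).injective

theorem p0_type {A : Set M} {D : Type u} [Cd M D] {d : D} {p0 : Ultrafilter D}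
    (hp0 : ∀ (C : Type u) (_ : Cd M C) (η : C → D → Prop), DR L M A η →
      ∀ k, DivA L M A η d k → ∀ c, ∀ᶠ s in p0, ¬ η c s)
    {P : D → Prop} (hP : DP L M A P) (hd : P d) : ∀ᶠ s in p0, P s := by
  have := hp0 (PEmpty.{u+1} → M) inferInstance (fun _ s => ¬ P s) (dp_not (dp_comp hP cm_snd')) 1
    ⟨fun _ => d, fun _ _ _ => Iff.rfl, ?_⟩ PEmpty.elim
  · simpa using this
  · rintro t ht ⟨c, hc⟩
    obtain ⟨i, hi⟩ := Finset.card_pos.1 (by omega : 0 < t.card)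
    exact hc i hi hd

variable (L M) in
/-- q agrees with p0 on definable sets -/
def Agree {D : Type u} [Cd M D] (p0 q : Ultrafilter D) : Prop :=
  ∀ P : D → Prop, DP L M Set.univ P → (∀ᶠ s in p0, P s) → ∀ᶠ s in q, P s

theorem Agree.rev {D : Type u} [Cd M D] {p0 q : Ultrafilter D} (h : Agree L M p0 q)
    {P : D → Prop} (hP : DP L M Set.univ P) (hq : ∀ᶠ s in q, P s) : ∀ᶠ s in p0, P s := by
  by_contra hcon
  have := h _ (dp_not hP) (Ultrafilter.eventually_not.2 hcon)
  obtain ⟨s, h1, h2⟩ := (hq.and this).exists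
  exact h2 h1

theorem exists_qs {κ : Cardinal.{u}} (hM : IsMonster L M κ) (hT : NTP2 L M)
    {C D : Type u} [Cd M C] [Cd M D] {p0 : Ultrafilter D} {η : C → D → Prop}
    (hη : DR L M Set.univ η) {k : ℕ} (hk : DivP L M p0 η k) :
    ∃ (m : ℕ) (qs : Fin m → Ultrafilter D), (∀ i, Agree L M p0 (qs i)) ∧
      ∀ᶠ s : Fin m → D in PQ m qs, ¬ ∃ c, ∀ l, η c (s l) := by
  classical
  obtain ⟨d0⟩ : Nonempty D := p0.neBot.nonempty
  let J := {P : D → Prop // DP L M Set.univ P ∧ ∀ᶠ s in p0, P s} × ℕ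
  have : Nonempty J := ⟨⟨fun _ => True, dp_const True, Filter.Eventually.of_forall fun _ => trivial⟩, 0⟩
  obtain ⟨r, hr⟩ := dirUlt (X := ℕ → D) (J := J)
    (fun j => {s | (∀ i < j.2, j.1.1 (s i)) ∧ KInc k η (fun i : Fin j.2 => s i)}) (by
      rintro ⟨P, p⟩ ⟨P', p'⟩
      refine ⟨⟨⟨fun s => P.1 s ∧ P'.1 s, dp_and P.2.1 P'.2.1, P.2.2.and P'.2.2⟩, max p p'⟩, ?_, ?_⟩
      · rintro s ⟨h1, h2⟩
        exact ⟨fun i hi => (h1 i (lt_of_lt_of_le hi (le_max_left _ _))).1,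
          h2.comp (Fin.castLE (le_max_left _ _)) (Fin.castLE_injective _)⟩
      · rintro s ⟨h1, h2⟩
        exact ⟨fun i hi => (h1 i (lt_of_lt_of_le hi (le_max_right _ _))).2,
          h2.comp (Fin.castLE (le_max_right _ _)) (Fin.castLE_injective _)⟩) (by
      rintro ⟨P, p⟩
      obtain ⟨s, h1, h2⟩ := hk P.1 P.2.1 P.2.2 p
      refine ⟨fun i => if h : i < p then s ⟨i, h⟩ else d0, ?_, ?_⟩
      · intro i hi
        have hi : i < p := hi
        simp only [hi, dif_pos]
        exact h1 _
      · simpa using h2)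
  by_contra hcon
  push Not at hcon
  have hcon' : ∀ (m : ℕ) (f : Fin m → ℕ), ∀ᶠ t : Fin m → ℕ → D in PQ m (fun _ => r), ∃ c, ∀ l, η c (t l (f l)) := by
    intro m f
    have := hcon m (fun l => r.map (fun s => s (f l))) (by
      intro l P hP hPl
      have := hr ⟨⟨P, hP, hPl⟩, f l + 1⟩
      show ∀ᶠ s : ℕ → D in r, P (s (f l))
      filter_upwards [this] with s hs
      exact hs.1 _ (Nat.lt_succ_self _))
    rw [ev_PQ_map] at this
    simpa using this
  refine noArr hM hT hη k (fun p => ?_)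
  have h1 : ∀ᶠ t : Fin p → ℕ → D in PQ p (fun _ => r), ∀ l, KInc k η (fun i : Fin p => t l i) := by
    refine ev_PQ_all (P := fun _ (s : ℕ → D) => KInc k η (fun i : Fin p => s i)) (fun l => ?_)
    have := hr ⟨⟨fun _ => True, dp_const True, Filter.Eventually.of_forall fun _ => trivial⟩, p⟩
    filter_upwards [this] with s hs
    exact hs.2
  have h2 : ∀ᶠ t : Fin p → ℕ → D in PQ p (fun _ => r), ∀ f : Fin p → Fin p, ∃ c, ∀ l, η c (t l (f l)) :=
    Filter.eventually_all.2 (fun f => hcon' p (fun l => f l))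
  obtain ⟨t, ht1, ht2⟩ := (h1.and h2).exists
  exact ⟨fun l i => t l i, ht1, ht2⟩

end ultra
section broom

variable {L M}

variable (L M) in
/-- broom property -/
def Brm {C D : Type u} [Cd M D] (p0 : Ultrafilter D) (R : C → D → Prop) : Prop :=
  ∀ (Γ : Type u) (_ : Cd M Γ) (V : Ultrafilter Γ) (W : Γ → D → Prop), DR L M Set.univ W →
    (∀ᶠ z in V, ∀ᶠ s in p0, W z s) → ∃ K : ℕ, ∀ᶠ z in V, ∃ S : Fin K → D,
      (∀ j, W z (S j)) ∧ ∀ x, ∃ j, ¬ R x (S j)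

theorem brm_inner {C D : Type u} [Cd M C] [Cd M D] {p0 : Ultrafilter D} {R : C → D → Prop}
    (hR : DR L M Set.univ R) (hB : Brm L M p0 R) (k : ℕ) :
    ∀ (qs : Fin k → Ultrafilter D), (∀ i, Agree L M p0 (qs i)) →
    ∀ (Γ : Type u) (_ : Cd M Γ) (V : Ultrafilter Γ) (Z : Γ → (Fin k → D) → Prop),
      DR L M Set.univ Z → (∀ᶠ z in V, ∀ᶠ s in PQ k qs, Z z s) →
      ∃ K : ℕ, ∀ᶠ z in V, ∃ T : Fin K → Fin k → D, (∀ i, Z z (T i)) ∧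
        ∀ x, ∃ i, ∀ l, ¬ R x (T i l) := by
  induction k with
  | zero =>
    intro qs hqs Γ _ V Z hZ hV
    refine ⟨1, ?_⟩
    filter_upwards [hV] with z hz
    exact ⟨fun _ => Fin.elim0, fun _ => hz, fun x => ⟨0, fun l => l.elim0⟩⟩
  | succ k ih =>
    intro qs hqs Γ _ V Z hZ hV
    obtain ⟨K1, hK1⟩ := ih (fun i => qs i.succ) (fun i => hqs i.succ) (Γ × D) inferInstance
      (UP V (qs 0)) (fun p s' => Z p.1 (Fin.cons p.2 s'))
      (dp_rel hZ (cm_fst cm_fst') (cm_cons (cm_snd cm_fst') cm_snd')) (by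
        rw [ev_UP]
        exact hV)
    rw [ev_UP] at hK1
    let Z' : Γ → D → Prop := fun z s => ∃ T : Fin K1 → Fin k → D,
      (∀ i, Z z (Fin.cons s (T i))) ∧ ∀ x, ∃ i, ∀ l, ¬ R x (T i l)
    have hZ' : DR L M Set.univ Z' := by
      refine dp_ex (dp_and (dp_fall fun i => ?_) (dp_all (dp_fex fun i => dp_fall fun l => dp_not ?_)))
      · exact dp_rel hZ (cm_fst cm_fst') (cm_cons (cm_snd cm_fst') (cm_app cm_snd' i))
      · exact dp_rel hR cm_snd' (cm_app (cm_app (cm_snd cm_fst') i) l)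
    obtain ⟨K2, hK2⟩ := hB Γ inferInstance V Z' hZ' (by
      filter_upwards [hK1] with z hz
      exact (hqs 0).rev (dp_fix hZ' z) hz)
    refine ⟨K2 * K1, ?_⟩
    filter_upwards [hK2] with z hz
    obtain ⟨S, hS1, hS2⟩ := hz
    choose T hT1 hT2 using hS1
    refine ⟨fun i => Fin.cons (S (finProdFinEquiv.symm i).1)
      (T (finProdFinEquiv.symm i).1 (finProdFinEquiv.symm i).2), fun i => hT1 _ _, fun x => ?_⟩
    obtain ⟨j, hj⟩ := hS2 x
    obtain ⟨i, hi⟩ := hT2 j x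
    refine ⟨finProdFinEquiv (j, i), fun l => ?_⟩
    beta_reduce
    rw [Equiv.symm_apply_apply]
    refine Fin.cases ?_ (fun l => ?_) l
    · simpa using hj
    · simpa using hi l

theorem brm_or {κ : Cardinal.{u}} (hM : IsMonster L M κ) (hT : NTP2 L M)
    {C C' D : Type u} [Cd M C] [Cd M C'] [Cd M D] {p0 : Ultrafilter D} {R : C → D → Prop}
    (hR : DR L M Set.univ R) (hB : Brm L M p0 R) {η : C' → D → Prop}
    (hη : DR L M Set.univ η) {k : ℕ} (hk : DivP L M p0 η k) :
    Brm L M p0 (fun (x : C × C') s => R x.1 s ∨ η x.2 s) := by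
  intro Γ _ V W hW hV
  obtain ⟨m, qs, hqs, hm⟩ := exists_qs hM hT hη hk
  obtain ⟨K, hK⟩ := brm_inner hR hB m qs hqs Γ inferInstance V
    (fun z s => (∀ l, W z (s l)) ∧ ¬ ∃ c, ∀ l, η c (s l))
    (dp_and (dp_fall fun l => dp_rel hW cm_fst' (cm_app cm_snd' l))
      (dp_not (dp_ex (dp_fall fun l => dp_rel hη cm_snd' (cm_app (cm_snd cm_fst') l))))) (by
    filter_upwards [hV] with z hz
    refine Filter.Eventually.and ?_ hm
    exact ev_PQ_all (P := fun _ s => W z s) (fun l => hqs l _ (dp_fix hW z) hz))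
  refine ⟨K * m, ?_⟩
  filter_upwards [hK] with z hz
  obtain ⟨T, hT1, hT2⟩ := hz
  refine ⟨fun i => T (finProdFinEquiv.symm i).1 (finProdFinEquiv.symm i).2,
    fun i => (hT1 _).1 _, fun x => ?_⟩
  obtain ⟨i, hi⟩ := hT2 x.1
  have h2 := (hT1 i).2
  push Not at h2
  obtain ⟨l, hl⟩ := h2 x.2
  refine ⟨finProdFinEquiv (i, l), ?_⟩
  beta_reduce
  rw [Equiv.symm_apply_apply]
  rintro (h | h)
  · exact hi l h
  · exact hl h

/-- external consistency -/
def Ext {C D : Type*} (η : C → D → Prop) (G : Set D) : Prop :=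
  ∀ F : Finset D, (↑F : Set D) ⊆ G → ∃ c, ∀ s ∈ F, η c s

theorem exists_q {κ : Cardinal.{u}} (hM : IsMonster L M κ) (hT : NTP2 L M)
    {D : Type u} [Cd M D] (p0 : Ultrafilter D) :
    ∃ q : Ultrafilter D, Agree L M p0 q ∧ ∀ (C : Type u) (_ : Cd M C) (η : C → D → Prop),
      DR L M Set.univ η → ∀ k, DivP L M p0 η k → ∀ G, Ext η G → ∀ᶠ s in q, s ∉ G := by
  classical
  let B : Set D → Prop := fun G => ∀ (C : Type u) (_ : Cd M C) (R : C → D → Prop) (H : Set D),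
    DR L M Set.univ R → Brm L M p0 R → Ext R H →
    ∃ (C' : Type u) (_ : Cd M C') (R' : C' → D → Prop), DR L M Set.univ R' ∧ Brm L M p0 R' ∧
      Ext R' (H ∪ G)
  have hB0 : B ∅ := fun C hC R H h1 h2 h3 => ⟨C, hC, R, h1, h2, by simpa using h3⟩
  have hBu : ∀ G G', B G → B G' → B (G ∪ G') := by
    intro G G' hG hG' C hC R H h1 h2 h3
    obtain ⟨C1, hC1, R1, h1, h2, h3⟩ := hG C hC R H h1 h2 h3
    obtain ⟨C1, hC1, R1, h1, h2, h3⟩ := hG' C1 hC1 R1 _ h1 h2 h3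
    exact ⟨C1, hC1, R1, h1, h2, by rwa [← Set.union_assoc]⟩
  have hBb : ∀ (C : Type u) (_ : Cd M C) (η : C → D → Prop),
      DR L M Set.univ η → ∀ k, DivP L M p0 η k → ∀ G, Ext η G → B G := by
    intro C' hC' η hη k hk G hG C hC R H h1 h2 h3
    refine ⟨C × C', inferInstance, _, ?_, brm_or hM hT h1 h2 hη hk, ?_⟩
    · exact dp_or (dp_rel h1 (cm_fst cm_fst') cm_snd') (dp_rel hη (cm_snd cm_fst') cm_snd')
    · intro F hF
      obtain ⟨c, hc⟩ := h3 (F.filter (· ∈ H)) (by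
        intro s hs
        simp at hs
        exact hs.2)
      obtain ⟨c', hc'⟩ := hG (F.filter (· ∈ G)) (by
        intro s hs
        simp at hs
        exact hs.2)
      refine ⟨(c, c'), fun s hs => ?_⟩
      rcases hF hs with h | h
      · exact Or.inl (hc s (by simp [hs, h]))
      · exact Or.inr (hc' s (by simp [hs, h]))
  let J := {P : D → Prop // DP L M Set.univ P ∧ ∀ᶠ s in p0, P s} × {G : Set D // B G}
  have hJ : Nonempty J := ⟨⟨fun _ => True, dp_const True, Filter.Eventually.of_forall fun _ => trivial⟩, ∅, hB0⟩
  obtain ⟨q, hq⟩ := dirUlt (J := J) (fun j => {s | j.1.1 s ∧ s ∉ j.2.1}) (by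
      rintro ⟨P, G⟩ ⟨P', G'⟩
      refine ⟨⟨⟨fun s => P.1 s ∧ P'.1 s, dp_and P.2.1 P'.2.1, P.2.2.and P'.2.2⟩,
        ⟨G.1 ∪ G'.1, hBu _ _ G.2 G'.2⟩⟩, ?_, ?_⟩
      · rintro s ⟨h1, h2⟩
        exact ⟨h1.1, fun h => h2 (Or.inl h)⟩
      · rintro s ⟨h1, h2⟩
        exact ⟨h1.2, fun h => h2 (Or.inr h)⟩) (by
      rintro ⟨P, G⟩
      by_contra hne
      obtain ⟨C', hC', R', h1, h2, h3⟩ := G.2 (PEmpty.{u+1} → M) inferInstance (fun _ _ => False) ∅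
        (dp_const False) (by
          intro Γ _ V W hW hV
          refine ⟨1, ?_⟩
          filter_upwards [hV] with z hz
          obtain ⟨s, hs⟩ := hz.exists
          exact ⟨fun _ => s, fun _ => hs, fun x => ⟨0, id⟩⟩) (by
          intro F hF
          refine ⟨PEmpty.elim, fun s hs => (hF hs).elim⟩)
      obtain ⟨K, hK⟩ := h2 (PEmpty.{u+1} → M) inferInstance (pure PEmpty.elim) (fun _ s => P.1 s)
        (dp_comp P.2.1 cm_snd') (Filter.Eventually.of_forall fun _ => P.2.2)
      obtain ⟨z, S, hS1, hS2⟩ := hK.exists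
      obtain ⟨c, hc⟩ := h3 (Finset.univ.image S) (by
        intro s hs
        simp at hs
        obtain ⟨j, rfl⟩ := hs
        right
        by_contra hcon
        exact hne ⟨_, hS1 j, hcon⟩)
      obtain ⟨j, hj⟩ := hS2 c
      exact hj (hc _ (by simp)))
  refine ⟨q, ?_, ?_⟩
  · intro P hP hPl
    filter_upwards [hq ⟨⟨P, hP, hPl⟩, ∅, hB0⟩] with s hs
    exact hs.1
  · intro C hC η hη k hk G hG
    filter_upwards [hq ⟨⟨fun _ => True, dp_const True, Filter.Eventually.of_forall fun _ => trivial⟩,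
      G, hBb C hC η hη k hk G hG⟩] with s hs
    exact hs.2

end broom
section kim

variable {L M}

variable (L M) in
/-- strictness of an ultrafilter -/
def Strict {D : Type u} [Cd M D] (p0 q : Ultrafilter D) : Prop :=
  ∀ (C : Type u) (_ : Cd M C) (η : C → D → Prop),
      DR L M Set.univ η → ∀ k, DivP L M p0 η k → ∀ G, Ext η G → ∀ᶠ s in q, s ∉ G

theorem row_ext {C D Γ : Type u} [Cd M C] [Cd M D] [Cd M Γ] {p0 q : Ultrafilter D}
    (hq : Strict L M p0 q) {ψ : C → D → Prop} (hψ : DR L M Set.univ ψ) {k : ℕ}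
    (hk : DivP L M p0 ψ k) (r : Ultrafilter Γ) {η : Γ → D → Prop} (hη : DR L M Set.univ η)
    (hr : ∀ᶠ s in q, ∀ᶠ c in r, η c s) (p : ℕ) :
    ∀ᶠ c in r, ∃ u : Fin p → D, KInc k ψ u ∧ ∀ t, η c (u t) := by
  let Ξ : Γ → Prop := fun c => ∃ u : Fin p → D, KInc k ψ u ∧ ∀ t, η c (u t)
  have hΞ : DP L M Set.univ Ξ := by
    refine dp_ex (dp_and ?_ (dp_fall fun j => dp_rel hη cm_fst' (cm_app cm_snd' j)))
    exact dp_kinc hψ k _ (fun j => cm_app cm_snd' j)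
  rcases Nat.eq_zero_or_pos p with rfl | hp
  · obtain ⟨u, -, hu⟩ := hk (fun _ => True) (dp_const True)
      (Filter.Eventually.of_forall fun _ => trivial) 0
    exact Filter.Eventually.of_forall fun c => ⟨u, hu, fun t => t.elim0⟩
  by_contra hcon
  have hcon : ∀ᶠ c in r, ¬ Ξ c := Ultrafilter.eventually_not.2 hcon
  let η' : Γ → D → Prop := fun c s => η c s ∧ ¬ Ξ c
  have hη' : DR L M Set.univ η' := dp_and hη (dp_not (dp_comp hΞ cm_fst'))
  let G : Set D := {s | ∀ᶠ c in r, η' c s}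
  have hG : ∀ᶠ s in q, s ∈ G := by
    filter_upwards [hr] with s hs
    exact hs.and hcon
  have hE : Ext η' G := by
    intro F hF
    have : ∀ᶠ c in r, ∀ s ∈ F, η' c s := (Filter.eventually_all_finset F).2 (fun s hs => hF hs)
    exact this.exists
  have hnd : ¬ DivP L M p0 η' p := by
    intro h
    obtain ⟨s, h1, h2⟩ := (hG.and (hq Γ inferInstance η' hη' p h G hE)).exists
    exact h2 h1
  refine hnd (fun P hP hPl p' => ?_)
  obtain ⟨s, hs1, hs2⟩ := hk P hP hPl p'
  refine ⟨s, hs1, ?_⟩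
  rintro t ht ⟨c, hc⟩
  obtain ⟨j, hj⟩ := Finset.card_pos.1 (by omega : 0 < t.card)
  refine (hc j hj).2 ⟨fun i => s (t.orderEmbOfFin ht i),
    hs2.comp _ (t.orderEmbOfFin ht).injective, fun i => (hc _ ?_).1⟩
  exact Finset.orderEmbOfFin_mem t ht i

theorem row_ult {C D Γ : Type u} [Cd M C] [Cd M D] [Cd M Γ] {p0 q : Ultrafilter D}
    (hq : Strict L M p0 q) {ψ : C → D → Prop} (hψ : DR L M Set.univ ψ) {k : ℕ}
    (hk : DivP L M p0 ψ k) (r : Ultrafilter Γ) (p : ℕ) :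
    ∃ r' : Ultrafilter (Γ × (Fin p → D)), (∀ Q : Γ → Prop, (∀ᶠ c in r, Q c) → ∀ᶠ z : Γ × (Fin p → D) in r', Q z.1) ∧
      (∀ᶠ z : Γ × (Fin p → D) in r', KInc k ψ z.2) ∧ ∀ η : Γ → D → Prop, DR L M Set.univ η →
      (∀ᶠ s in q, ∀ᶠ c in r, η c s) → ∀ᶠ z : Γ × (Fin p → D) in r', ∀ t, η z.1 (z.2 t) := by
  let J := {Q : Γ → Prop // ∀ᶠ c in r, Q c} × {η : Γ → D → Prop // DR L M Set.univ η ∧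
      (∀ᶠ s in q, ∀ᶠ c in r, η c s)}
  let j0 : J := ⟨⟨fun _ => True, Filter.Eventually.of_forall fun _ => trivial⟩,
    ⟨fun _ _ => True, dp_const True, Filter.Eventually.of_forall fun _ =>
      Filter.Eventually.of_forall fun _ => trivial⟩⟩
  have hJ : Nonempty J := ⟨j0⟩
  obtain ⟨r', hr'⟩ := dirUlt (X := Γ × (Fin p → D)) (J := J)
    (fun j => {z | j.1.1 z.1 ∧ KInc k ψ z.2 ∧ ∀ t, j.2.1 z.1 (z.2 t)}) (by
    rintro ⟨Q, η⟩ ⟨Q', η'⟩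
    refine ⟨⟨⟨fun c => Q.1 c ∧ Q'.1 c, Q.2.and Q'.2⟩, ⟨fun c s => η.1 c s ∧ η'.1 c s,
      dp_and η.2.1 η'.2.1, ?_⟩⟩, ?_, ?_⟩
    · filter_upwards [η.2.2, η'.2.2] with s h1 h2 using h1.and h2
    · rintro z ⟨h1, h2, h3⟩
      exact ⟨h1.1, h2, fun t => (h3 t).1⟩
    · rintro z ⟨h1, h2, h3⟩
      exact ⟨h1.2, h2, fun t => (h3 t).2⟩) (by
    rintro ⟨Q, η⟩
    obtain ⟨c, hc, u, hu1, hu2⟩ := (Q.2.and (row_ext hq hψ hk r η.2.1 η.2.2 p)).exists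
    exact ⟨(c, u), hc, hu1, hu2⟩)
  refine ⟨r', fun Q hQ => ?_, ?_, fun η hη hr => ?_⟩
  · filter_upwards [hr' ⟨⟨Q, hQ⟩, j0.2⟩] with z hz using hz.1
  · filter_upwards [hr' j0] with z hz using hz.2.1
  · filter_upwards [hr' ⟨j0.1, ⟨η, hη, hr⟩⟩] with z hz using hz.2.2

theorem rows_ult {C D : Type u} [Cd M C] [Cd M D] {p0 q : Ultrafilter D}
    (hq : Strict L M p0 q) {ψ : C → D → Prop} (hψ : DR L M Set.univ ψ) {k : ℕ}
    (hk : DivP L M p0 ψ k) (p n : ℕ) :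
    ∃ r : Ultrafilter (Fin n → Fin p → D), (∀ Y : (Fin n → D) → Prop, DP L M Set.univ Y →
      (∀ᶠ s in PQ n (fun _ => q), Y s) →
        ∀ᶠ u : Fin n → Fin p → D in r, ∀ f : Fin n → Fin p, Y (fun l => u l (f l))) ∧
      ∀ᶠ u : Fin n → Fin p → D in r, ∀ l, KInc k ψ (u l) := by
  induction n with
  | zero =>
    refine ⟨pure Fin.elim0, fun Y hY h => ?_, Filter.Eventually.of_forall fun u l => l.elim0⟩
    refine Filter.Eventually.of_forall fun u f => ?_
    rw [ev_PQ_zero] at h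
    convert h using 1
  | succ n ih =>
    obtain ⟨r, hr1, hr2⟩ := ih
    obtain ⟨r', h1, h2, h3⟩ := row_ult hq hψ hk r p
    refine ⟨r'.map (fun z => Fin.cons z.2 z.1), fun Y hY h => ?_, ?_⟩
    · rw [ev_PQ_succ] at h
      have hY' : DR L M Set.univ (fun (s : D) (s' : Fin n → D) => Y (Fin.cons s s')) :=
        dp_comp hY (cm_cons cm_fst' cm_snd')
      have h4 := h3 (fun u s => ∀ f : Fin n → Fin p, Y (Fin.cons s (fun l => u l (f l))))
        (dp_fall fun f => dp_comp hY (cm_cons cm_snd'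
          (cm_pi fun l => cm_app (cm_app cm_fst' l) (f l)))) (by
          filter_upwards [h] with s hs
          exact hr1 _ (dp_fix hY' s) hs)
      show ∀ᶠ z : (Fin n → Fin p → D) × (Fin p → D) in r', ∀ f : Fin (n + 1) → Fin p,
        Y (fun l => (Fin.cons z.2 z.1 : Fin (n + 1) → Fin p → D) l (f l))
      filter_upwards [h4] with z hz f
      convert hz (f 0) (fun l => f l.succ) using 1
      funext l
      refine Fin.cases ?_ (fun l => ?_) l <;> simp
    · show ∀ᶠ z : (Fin n → Fin p → D) × (Fin p → D) in r', ∀ l, KInc k ψ ((Fin.cons z.2 z.1 : Fin (n + 1) → Fin p → D) l)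
      filter_upwards [h2, h1 _ hr2] with z hz1 hz2 l
      refine Fin.cases ?_ (fun l => ?_) l
      · simpa using hz1
      · simpa using hz2 l

theorem kim {κ : Cardinal.{u}} (hM : IsMonster L M κ) (hT : NTP2 L M)
    {C D : Type u} [Cd M C] [Cd M D] {p0 q : Ultrafilter D}
    (hq : Strict L M p0 q) {ψ : C → D → Prop} (hψ : DR L M Set.univ ψ) {k : ℕ}
    (hk : DivP L M p0 ψ k) :
    ∃ m : ℕ, ∀ᶠ s : Fin m → D in PQ m (fun _ => q), ¬ ∃ x, ∀ l, ψ x (s l) := by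
  by_contra hcon
  push Not at hcon
  refine noArr hM hT hψ k (fun p => ?_)
  obtain ⟨r, hr1, hr2⟩ := rows_ult hq hψ hk p p
  have h1 := hr1 (fun s => ∃ x, ∀ l, ψ x (s l))
    (dp_ex (dp_fall fun l => dp_rel hψ cm_snd' (cm_app cm_fst' l)))
    (by simpa using (hcon p))
  obtain ⟨u, h1, h2⟩ := (h1.and hr2).exists
  exact ⟨u, h2, h1⟩

theorem ev_PQ_sub {X : Type*} (q : Ultrafilter X) (p : ℕ) : ∀ (m : ℕ) (g : Fin m → Fin p),
    StrictMono g → ∀ Z : (Fin m → X) → Prop, (∀ᶠ s in PQ m (fun _ => q), Z s) →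
    ∀ᶠ s : Fin p → X in PQ p (fun _ => q), Z (fun i => s (g i)) := by
  induction p with
  | zero =>
    intro m g hg Z hZ
    rcases m with _ | m
    · rw [ev_PQ_zero] at hZ
      refine Filter.Eventually.of_forall fun s => ?_
      convert hZ using 1
    · exact (g 0).elim0
  | succ p ih =>
    intro m g hg Z hZ
    rcases m with _ | m
    · rw [ev_PQ_zero] at hZ
      refine Filter.Eventually.of_forall fun s => ?_
      convert hZ using 1
    · rw [ev_PQ_succ]
      by_cases h0 : g 0 = 0
      · rw [ev_PQ_succ] at hZ
        have hne : ∀ i : Fin m, g i.succ ≠ 0 := fun i h => by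
          have := hg (Fin.succ_pos i)
          rw [h] at this
          exact absurd this (Fin.not_lt_zero _)
        filter_upwards [hZ] with x hx
        have := ih m (fun i => (g i.succ).pred (hne i)) (fun i j hij => by
          have := hg (Fin.succ_lt_succ_iff.2 hij)
          exact Fin.pred_lt_pred_iff.2 this) _ hx
        filter_upwards [this] with s hs
        convert hs using 1
        funext i
        refine Fin.cases ?_ (fun i => ?_) i
        · simp [h0]
        · conv_lhs => rw [← Fin.succ_pred (g i.succ) (hne i)]
          simp only [Fin.cons_succ]
      · have hne : ∀ i : Fin (m + 1), g i ≠ 0 := fun i h => by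
          have := hg.monotone (Fin.zero_le i)
          rw [h] at this
          exact h0 (Fin.le_zero_iff.1 this)
        refine Filter.Eventually.of_forall fun x => ?_
        have := ih (m + 1) (fun i => (g i).pred (hne i)) (fun i j hij => by
          have := hg hij
          exact Fin.pred_lt_pred_iff.2 this) _ hZ
        filter_upwards [this] with s hs
        convert hs using 1
        funext i
        conv_lhs => rw [← Fin.succ_pred (g i) (hne i)]
        simp only [Fin.cons_succ]

theorem ev_kinc {C D : Type*} (q : Ultrafilter D) (Φ : C → D → Prop) (n : ℕ)
    (ψ : Fin n → C → D → Prop) (m : Fin n → ℕ)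
    (hm : ∀ i, ∀ᶠ s : Fin (m i) → D in PQ (m i) (fun _ => q), ¬ ∃ x, ∀ l, ψ i x (s l))
    (hΦ : ∀ᶠ s in q, ∀ x, Φ x s → ∃ i, ψ i x s) (p : ℕ) :
    ∀ᶠ s : Fin p → D in PQ p (fun _ => q), KInc (∑ i, m i + 1) Φ s := by
  classical
  have h1 : ∀ᶠ s : Fin p → D in PQ p (fun _ => q), ∀ l, ∀ x, Φ x (s l) → ∃ i, ψ i x (s l) :=
    ev_PQ_all (P := fun _ s => ∀ x, Φ x s → ∃ i, ψ i x s) (fun _ => hΦ)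
  have h2 : ∀ᶠ s : Fin p → D in PQ p (fun _ => q), ∀ (i : Fin n) (g : Fin (m i) → Fin p),
      StrictMono g → ¬ ∃ x, ∀ l, ψ i x (s (g l)) := by
    refine Filter.eventually_all.2 (fun i => Filter.eventually_all.2 (fun g => ?_))
    by_cases hg : StrictMono g
    · filter_upwards [ev_PQ_sub q p (m i) g hg _ (hm i)] with s hs _ using hs
    · exact Filter.Eventually.of_forall fun s h => (hg h).elim
  filter_upwards [h1, h2] with s hs1 hs2
  rintro t ht ⟨x, hx⟩
  have h3 : ∀ l : Fin p, ∃ i : Fin n, l ∈ t → ψ i x (s l) := by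
    intro l
    by_cases hl : l ∈ t
    · obtain ⟨i, hi⟩ := hs1 l x (hx l hl)
      exact ⟨i, fun _ => hi⟩
    · have : t.Nonempty := Finset.card_pos.1 (by omega)
      obtain ⟨l', hl'⟩ := this
      obtain ⟨i, hi⟩ := hs1 l' x (hx l' hl')
      exact ⟨i, fun h => (hl h).elim⟩
  choose c hc using h3
  have h4 : ∃ i, m i ≤ (t.filter (fun l => c l = i)).card := by
    by_contra hcon
    push Not at hcon
    have h5 := Finset.card_eq_sum_card_fiberwise (s := t) (t := Finset.univ) (f := c) (by simp)
    have h6 : ∑ i, (t.filter (fun l => c l = i)).card ≤ ∑ i, m i :=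
      Finset.sum_le_sum (fun i _ => (hcon i).le)
    omega
  obtain ⟨i, hi⟩ := h4
  obtain ⟨t', ht', hcard⟩ := Finset.exists_subset_card_eq hi
  refine hs2 i (t'.orderEmbOfFin hcard) (t'.orderEmbOfFin hcard).strictMono ⟨x, fun l => ?_⟩
  have h7 := ht' (Finset.orderEmbOfFin_mem t' hcard l)
  rw [Finset.mem_filter] at h7
  have h8 := hc _ h7.1
  rw [h7.2] at h8
  exact h8

theorem core {κ : Cardinal.{u}} (hM : IsMonster L M κ) (hT : NTP2 L M) {A : Set M}
    (hAκ : Cardinal.mk A < κ) (hA : ForkingExtBase L M A)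
    {C D : Type u} [Cd M C] [Cd M D] (d : D) (Φ : C → D → Prop) (hΦ : DR L M A Φ)
    (n : ℕ) (ψ : Fin n → C → D → Prop) (hψ : ∀ i, DR L M A (ψ i))
    (hd : ∀ i, ∃ k, DivA L M A (ψ i) d k) (himp : ∀ x, Φ x d → ∃ i, ψ i x d) :
    ∃ K, DivA L M A Φ d K := by
  classical
  obtain ⟨p0, hp0⟩ := exists_p0 hA d
  obtain ⟨q, hq1, hq2⟩ := exists_q hM hT p0
  have hq2 : Strict L M p0 q := hq2
  choose k hk using hd
  have hm : ∀ i, ∃ m : ℕ, ∀ᶠ s : Fin m → D in PQ m (fun _ => q), ¬ ∃ x, ∀ l, ψ i x (s l) :=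
    fun i => kim hM hT hq2 (dp_univ (hψ i)) (divP_of_divA hp0 (hψ i) (hk i))
  choose m hm using hm
  have himp' : DP L M A (fun s => ∀ x, Φ x s → ∃ i, ψ i x s) :=
    dp_all (dp_imp (dp_rel hΦ cm_snd' cm_fst') (dp_fex fun i => dp_rel (hψ i) cm_snd' cm_fst'))
  have hK := ev_kinc q Φ n ψ m hm (hq1 _ (dp_univ himp') (p0_type hp0 himp' himp))
  let J := {P : D → Prop // DP L M A P ∧ P d} × ℕ
  have hh := sat_seq hM A hAκ (D := D) (J := J) (fun j => j.2) (fun j i => i)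
    (fun j s => (∀ l, j.1.1 (s l)) ∧ KInc (∑ i, m i + 1) Φ s) ?_ ?_
  · obtain ⟨s, hs⟩ := hh
    refine ⟨∑ i, m i + 1, s, fun i P hP => ?_, ?_⟩
    · by_cases hPd : P d
      · have := (hs ⟨⟨P, hP, hPd⟩, i + 1⟩).1 ⟨i, Nat.lt_succ_self i⟩
        exact ⟨fun _ => hPd, fun _ => this⟩
      · have := (hs ⟨⟨fun s => ¬ P s, dp_not hP, hPd⟩, i + 1⟩).1 ⟨i, Nat.lt_succ_self i⟩
        exact ⟨fun h => (this h).elim, fun h => (hPd h).elim⟩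
    · rintro t ht ⟨c, hc⟩
      have hlt : ∀ m ∈ t, m < t.sup id + 1 := fun m hm =>
        Nat.lt_succ_of_le (Finset.le_sup (f := id) hm)
      have h1 := (hs ⟨⟨fun _ => True, dp_const True, trivial⟩, t.sup id + 1⟩).2
      exact h1 (t.attachFin hlt) (by simpa using ht) ⟨c, fun i hi => hc i (by simpa using hi)⟩
  · intro j
    exact dp_and (dp_fall fun l => dp_comp j.1.2.1 (cm_app cm_id l))
      (dp_kinc hΦ _ _ (fun l => cm_app cm_id l))
  · intro t
    let p := t.sup (fun j => j.2)
    have h1 : ∀ᶠ s : Fin p → D in PQ p (fun _ => q), ∀ l, ∀ j ∈ t, j.1.1 (s l) := by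
      refine ev_PQ_all (P := fun _ s => ∀ j ∈ t, j.1.1 s) (fun l => ?_)
      refine (Filter.eventually_all_finset t).2 (fun j hj => ?_)
      exact hq1 _ (dp_univ j.1.2.1) (p0_type hp0 j.1.2.1 j.1.2.2)
    obtain ⟨s, hs1, hs2⟩ := (h1.and (hK p)).exists
    refine ⟨fun i => if h : i < p then s ⟨i, h⟩ else d, fun j hj => ?_⟩
    have hjp : j.2 ≤ p := Finset.le_sup (f := fun j : J => j.2) hj
    have : (fun i : Fin j.2 => if h : (i : ℕ) < p then s ⟨i, h⟩ else d) =
        fun i => s (Fin.castLE hjp i) := by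
      funext i
      rw [dif_pos (lt_of_lt_of_le i.2 hjp)]
      rfl
    show (∀ l, j.1.1 ((fun i : Fin j.2 => if h : (i : ℕ) < p then s ⟨i, h⟩ else d) l)) ∧
      KInc _ Φ (fun i : Fin j.2 => if h : (i : ℕ) < p then s ⟨i, h⟩ else d)
    rw [this]
    exact ⟨fun l => hs1 _ j hj, hs2.comp _ (Fin.castLE_injective hjp)⟩

end kim
section final

variable {L M}

theorem fin_restrict {α β : Type u} (φ : L.Formula (α ⊕ β)) :
    ∃ (s0 : Finset α) (t0 : Finset β), ∀ s : Finset α, s0 ⊆ s →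
      ∃ φ' : L.Formula (s ⊕ t0), ∀ (x : α → M) (y : β → M),
        φ'.Realize (Sum.elim (fun i : s => x i) (fun i : t0 => y i)) ↔
          φ.Realize (Sum.elim x y) := by
  classical
  let F := φ.freeVarFinset
  refine ⟨F.toLeft, F.toRight, fun s hs => ?_⟩
  let f : F → s ⊕ F.toRight := fun z => match z with
    | ⟨Sum.inl i, hi⟩ => Sum.inl ⟨i, hs (Finset.mem_toLeft.2 hi)⟩
    | ⟨Sum.inr i, hi⟩ => Sum.inr ⟨i, Finset.mem_toRight.2 hi⟩
  refine ⟨Language.BoundedFormula.restrictFreeVar φ f, fun x y => ?_⟩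
  refine Language.BoundedFormula.realize_restrictFreeVar _ ?_
  rintro ⟨i | i, hi⟩ <;> rfl

theorem aut_dp {A : Set M} {D : Type u} [Finite D] (σ : M ≃[L] M) (hσ : FixesSet L M σ A)
    (d : D → M) {P : (D → M) → Prop} (hP : DP L M A P) : P (fun i => σ (d i)) ↔ P d := by
  obtain ⟨φ, hφ⟩ := dp_formula hP
  rw [hφ, hφ, ← Language.StrongHomClass.realize_formula σ φ (v := Sum.elim (Cd.e d) _)]
  apply iff_of_eq
  congr 1
  funext i
  rcases i with i | i
  · rfl
  · exact (hσ i i.2).symm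

theorem aut_eq {A : Set M} {δ : Type u} (σ : M ≃[L] M) (hσ : FixesSet L M σ A)
    (d : δ → M) : EqTypeOver L M A (fun i => σ (d i)) d := by
  intro γ φ c hc
  rw [← Language.StrongHomClass.realize_formula σ φ (v := Sum.elim d c)]
  apply iff_of_eq
  congr 1
  funext i
  rcases i with i | i
  · rfl
  · exact (hσ _ (hc ⟨i, rfl⟩)).symm

theorem forks_divides {κ : Cardinal.{u}} (hM : IsMonster L M κ) (hT : NTP2 L M) {A : Set M}
    (hAκ : Cardinal.mk A < κ) (hA : ForkingExtBase L M A) {α β : Type u}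
    (φ : L.Formula (α ⊕ β)) (a : β → M) (h : Forks L M A φ a) : Divides L M A φ a := by
  classical
  by_cases hx0 : Nonempty (α → M)
  swap
  · exact ⟨0, fun _ => a, fun _ _ _ _ _ => Iff.rfl, fun s _ h => hx0 ⟨h.choose⟩⟩
  obtain ⟨x0⟩ := hx0
  obtain ⟨n, γ, ψ, c, hdiv, himp⟩ := h
  obtain ⟨s0, t0, h0⟩ := fin_restrict (M := M) φ
  have h1 := fun i => fin_restrict (M := M) (ψ i)
  choose s1 t1 h1 using h1
  let S : Finset α := s0 ∪ Finset.univ.biUnion s1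
  obtain ⟨φ', hφ'⟩ := h0 S Finset.subset_union_left
  have h1 := fun i => h1 i S ((Finset.subset_biUnion_of_mem s1 (Finset.mem_univ i)).trans
    Finset.subset_union_right)
  choose ψ' hψ' using h1
  let Id := t0 ⊕ (Σ i, t1 i)
  let d : Id → M := Sum.elim (fun i => a i) (fun p => c p.1 p.2)
  let E : (S → M) → α → M := fun x i => if h : i ∈ S then x ⟨i, h⟩ else x0 i
  have hE : ∀ x : S → M, (fun i : S => E x i) = x := by
    intro x
    funext i
    exact dif_pos i.2
  let Φ : (S → M) → (Id → M) → Prop := fun x s =>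
    φ'.Realize (Sum.elim x (fun i => s (Sum.inl i)))
  let η : Fin n → (S → M) → (Id → M) → Prop := fun i x s =>
    (ψ' i).Realize (Sum.elim x (fun g => s (Sum.inr ⟨i, g⟩)))
  have hΦr : ∀ (x : S → M) (s : Id → M) (b : β → M), (∀ i : t0, s (Sum.inl i) = b i) →
      (Φ x s ↔ φ.Realize (Sum.elim (E x) b)) := by
    intro x s b hs
    rw [← hφ', hE]
    show Language.Formula.Realize _ _ ↔ _
    rw [funext hs]
  have hηr : ∀ i (x : S → M) (s : Id → M) (b : γ i → M),
      (∀ g : t1 i, s (Sum.inr ⟨i, g⟩) = b g) →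
      (η i x s ↔ (ψ i).Realize (Sum.elim (E x) b)) := by
    intro i x s b hs
    rw [← hψ', hE]
    show Language.Formula.Realize _ _ ↔ _
    rw [funext hs]
  have hκ : ∀ (δ : Type u) [Finite δ], Cardinal.mk δ < κ := fun δ _ =>
    (Cardinal.lt_aleph0_of_finite δ).trans hM.aleph0_lt
  have hgen : ∀ (δ : Type u) [Finite δ] (θ : L.Formula (S ⊕ δ)) (g : δ → Id),
      DR L M A (fun (x : S → M) (s : Id → M) => θ.Realize (Sum.elim x (fun i => s (g i)))) := by
    intro δ _ θ g
    have := dp_of_formula (L := L) (M := M) (A := A) (X := (S → M) × (Id → M)) (γ := PEmpty)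
      (θ.relabel (fun z => Sum.inl (Sum.map id g z))) PEmpty.elim (fun i => i.elim)
    refine dp_congr this ?_
    intro z
    rw [Language.Formula.realize_relabel]
    apply iff_of_eq
    congr 1
    funext i
    rcases i with i | i <;> rfl
  obtain ⟨K, ds, hds, hK⟩ := core hM hT hAκ hA d Φ (hgen _ φ' Sum.inl) n η
    (fun i => hgen _ (ψ' i) (fun g => Sum.inr ⟨i, g⟩)) (by
      intro i
      obtain ⟨k, bs, hbs, hk⟩ := hdiv i
      have hσ : ∀ j, ∃ σ : M ≃[L] M, FixesSet L M σ A ∧ ∀ g : t1 i, σ (c i g) = bs j g := by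
        intro j
        refine hM.homogeneous A hAκ (t1 i) (hκ _) (fun g => c i g) (fun g => bs j g) ?_
        intro δ θ e he
        have := hbs j δ (θ.relabel (Sum.map Subtype.val id)) e he
        rw [Language.Formula.realize_relabel, Language.Formula.realize_relabel] at this
        have hh : ∀ b : γ i → M, (Sum.elim b e ∘ Sum.map Subtype.val id : t1 i ⊕ δ → M) =
            Sum.elim (fun g : t1 i => b g) e := by
          intro b
          funext z
          rcases z with z | z <;> rfl
        rw [hh, hh] at this
        exact this.symm
      choose σ hσ1 hσ2 using hσ
      refine ⟨k, fun j z => σ j (d z), fun j P hP => aut_dp (σ j) (hσ1 j) d hP, ?_⟩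
      rintro t ht ⟨x, hx⟩
      refine hk t ht ⟨E x, fun j hj => ?_⟩
      exact (hηr i x (fun z => σ j (d z)) (bs j) (fun g => hσ2 j g)).1 (hx j hj)) (by
      intro x hx
      obtain ⟨i, hi⟩ := himp (E x) ((hΦr x d a (fun _ => rfl)).1 hx)
      exact ⟨i, (hηr i x d (c i) (fun _ => rfl)).2 hi⟩)
  have hτ : ∀ j, ∃ τ : M ≃[L] M, FixesSet L M τ A ∧ ∀ z : Id, τ (d z) = ds j z := by
    intro j
    refine hM.homogeneous A hAκ Id (hκ _) d (ds j) ?_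
    intro δ θ e he
    exact (hds j _ (dp_of_formula (X := Id → M) θ e (fun i => he ⟨i, rfl⟩))).symm
  choose τ hτ1 hτ2 using hτ
  refine ⟨K, fun j i => τ j (a i), fun j => aut_eq (τ j) (hτ1 j) a, ?_⟩
  rintro t ht ⟨x, hx⟩
  refine hK t ht ⟨fun i => x i, fun j hj => ?_⟩
  have h2 := (hφ' x (fun i => τ j (a i))).2 (hx j hj)
  have h3 : (fun i : t0 => ds j (Sum.inl i)) = fun i : t0 => τ j (a i) := by
    funext i
    rw [← hτ2]
    rfl
  show φ'.Realize _
  rw [h3]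
  exact h2

end final

/-- In an NTP₂ theory in which every small set is an extension
base for non-forking, forking equals dividing over every small set. -/
theorem forkEqDiv_of_all_extension_bases
    (κ : Cardinal.{u}) (hM : IsMonster L M κ) (hT : NTP2 L M)
    (hext : ∀ A : Set M, Cardinal.mk A < κ → ForkingExtBase L M A) :
    ∀ A : Set M, Cardinal.mk A < κ →
      ∀ (α β : Type u) (φ : L.Formula (α ⊕ β)) (a : β → M),
        Forks L M A φ a ↔ Divides L M A φ a := by
  intro A hA α β φ a
  refine ⟨fun h => forks_divides hM hT hA (hext A hA) φ a h, fun h => ?_⟩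
  exact ⟨1, fun _ => β, fun _ => φ, fun _ => a, fun _ => h, fun x hx => ⟨0, hx⟩⟩

end ForkingNTP2
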